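/- Let N ≥ 1, k ≥ 1, and let Q be a positive divisor of N with gcd(Q, N/Q) = 1. Choose x, y, z, w ∈ ℤ with x ≡ 1 (mod N/Q), y ≡ 1 (mod Q) and Q²xw − Nyz = Q, and for f : ℍ → ℂ define (f|_k W_Q)(τ) = Q^{k/2} (Nzτ + Qw)^{−k} f((Qxτ + y)/(Nzτ + Qw)). Then for every modular form f of weight k on Γ₁(N), the function f|_k W_Q is a modular form of weight k on Γ₁(N), and every Fourier coefficient of f|_k W_Q lies in the set Q^{k/2}·K_f(ζ_Q) = {Q^{k/2}·t : t ∈ K_f(ζ_Q)}. -/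

import Mathlib

open Complex UpperHalfPlane CongruenceSubgroup
open scoped ModularForm MatrixGroups Real

noncomputable section

/-- `ζ_N = e^{2πi/N}`. -/
def zetaC (N : ℕ) : ℂ := Complex.exp (2 * Real.pi * Complex.I / N)

/-- `f` has the Fourier expansion `Σ_{n ≥ 0} c n · e^{2πinτ/N}`. -/
def HasExpansion (N : ℕ) (f : ℍ → ℂ) (c : ℕ → ℂ) : Prop :=
  ∀ τ : ℍ, HasSum (fun n : ℕ => c n * Complex.exp (2 * Real.pi * Complex.I * n * (τ : ℂ) / N)) (f τ)

theorem liftAux {A S M : Type} [CommRing A] [IsDomain A] [Field S] [Field M] [Algebra A S]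
    [Algebra.IsAlgebraic A S] [IsAlgClosed M] (hS : Function.Injective (algebraMap A S))
    (e : A →+* M) (he : Function.Injective e) :
    ∃ σ : S →+* M, ∀ r : A, σ (algebraMap A S r) = e r := by
  letI : Algebra A M := e.toAlgebra
  have h1 : Module.IsTorsionFree A S := Module.isTorsionFree_iff_algebraMap_injective.2 hS
  have h2 : Module.IsTorsionFree A M := Module.isTorsionFree_iff_algebraMap_injective.2 he
  let ff : S →ₐ[A] M := IsAlgClosed.lift
  exact ⟨ff, fun r => ff.commutes r⟩

theorem extHom {R : Type} [CommRing R] [IsDomain R] [Algebra R ℂ]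
    (hinj : Function.Injective (algebraMap R ℂ)) (α : R →+* R) (hα : Function.Injective α) :
    ∃ σ : ℂ →+* ℂ, ∀ r, σ (algebraMap R ℂ r) = algebraMap R ℂ (α r) := by
  have : FaithfulSMul R ℂ := (faithfulSMul_iff_algebraMap_injective R ℂ).2 hinj
  obtain ⟨s, hs⟩ := exists_isTranscendenceBasis R ℂ
  let v : s → ℂ := fun i => i.1
  let A := Algebra.adjoin R (Set.range v)
  let e0 : MvPolynomial s R →+* ℂ := MvPolynomial.eval₂Hom ((algebraMap R ℂ).comp α) v
  have he0 : Function.Injective e0 := by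
    have : e0 = ((MvPolynomial.aeval v : MvPolynomial s R →ₐ[R] ℂ) : MvPolynomial s R →+* ℂ).comp
        (MvPolynomial.map α) := by
      apply MvPolynomial.ringHom_ext <;> intro i <;> simp [e0]
    rw [this]
    have h1 : Function.Injective (MvPolynomial.aeval v : MvPolynomial s R →ₐ[R] ℂ) := hs.1
    exact h1.comp (MvPolynomial.map_injective α hα)
  let e1 : A ≃ₐ[R] MvPolynomial s R := hs.1.aevalEquiv.symm
  let e : A →+* ℂ := e0.comp (e1 : A →+* MvPolynomial s R)
  have he : Function.Injective e := he0.comp e1.injective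
  have : Algebra.IsAlgebraic A ℂ := hs.isAlgebraic
  obtain ⟨σ, hσ⟩ := liftAux (A := A) (S := ℂ) Subtype.val_injective e he
  refine ⟨σ, fun r => ?_⟩
  have := hσ (algebraMap R A r)
  rw [show (algebraMap A ℂ) (algebraMap R A r) = algebraMap R ℂ r from rfl] at this
  rw [this]
  simp [e, e0]

theorem exists_aut_moving (F : Subfield ℂ) (x : ℂ) (hx : x ∉ F) :
    ∃ σ : ℂ →+* ℂ, (∀ a ∈ F, σ a = a) ∧ σ x ≠ x := by
  by_cases h : IsAlgebraic F x
  · let E := algebraicClosure F ℂ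
    let x' : E := ⟨x, (mem_algebraicClosure_iff).2 h⟩
    have : IsGalois F E := by
      have : IsAlgClosure F E := inferInstance
      have : Normal F E := IsAlgClosure.normal F E
      exact ⟨⟩
    have hx' : x' ∉ (⊥ : IntermediateField F E) := by
      intro hm
      obtain ⟨y, hy⟩ := IntermediateField.mem_bot.1 hm
      apply hx
      have := congrArg (fun t : E => (t : ℂ)) hy
      have h2 : (y : ℂ) = x := this
      rw [← h2]; exact y.2
    rw [InfiniteGalois.mem_bot_iff_fixed] at hx'
    push Not at hx'
    obtain ⟨g, hg⟩ := hx'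
    obtain ⟨σ, hσ⟩ := extHom (R := E) (FaithfulSMul.algebraMap_injective E ℂ) (g : E →+* E) g.injective
    refine ⟨σ, fun a ha => ?_, fun hh => hg ?_⟩
    · have := hσ (algebraMap F E ⟨a, ha⟩)
      simp at this
      exact this
    · have := hσ x'
      apply Subtype.ext
      exact this.symm.trans hh
  · let alg : Algebra (Polynomial F) ℂ := ((Polynomial.aeval x : Polynomial F →ₐ[F] ℂ) : Polynomial F →+* ℂ).toAlgebra
    have hx2 : Transcendental F x := h
    obtain ⟨σ, hσ⟩ := @extHom (Polynomial F) _ _ alg (transcendental_iff_injective.1 hx2)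
      ((Polynomial.compRingHom (Polynomial.X + 1))) (by
        intro p q hpq
        have h2 : ∀ r : Polynomial F, (r.comp (Polynomial.X + 1)).comp (Polynomial.X - 1) = r := by
          intro r; rw [Polynomial.comp_assoc]; simp
        have : p.comp (Polynomial.X + 1) = q.comp (Polynomial.X + 1) := hpq
        rw [← h2 p, ← h2 q, this])
    have key : ∀ r : Polynomial F, σ (Polynomial.aeval x r) = Polynomial.aeval x (r.comp (Polynomial.X + 1)) := hσ
    refine ⟨σ, fun a ha => ?_, fun hh => ?_⟩
    · have := key (Polynomial.C ⟨a, ha⟩)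
      simp only [Polynomial.C_comp, Polynomial.aeval_C] at this
      exact this
    · have := key Polynomial.X
      simp [hh] at this

/-- expansion by a power series -/
def HE (M : ℕ) (f : ℍ → ℂ) (p : PowerSeries ℂ) : Prop :=
  HasExpansion M f (fun n => PowerSeries.coeff n p)

theorem exp_eq_qParam (M n : ℕ) (τ : ℍ) :
    Complex.exp (2 * Real.pi * Complex.I * n * (τ : ℂ) / M)
      = (Function.Periodic.qParam (M : ℝ) (τ : ℂ)) ^ n := by
  rw [Function.Periodic.qParam, ← Complex.exp_nat_mul]
  congr 1
  push_cast
  ring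

theorem HE_iff {M : ℕ} {f : ℍ → ℂ} {p : PowerSeries ℂ} :
    HE M f p ↔ ∀ τ : ℍ, HasSum (fun n : ℕ => PowerSeries.coeff n p *
      (Function.Periodic.qParam (M : ℝ) (τ : ℂ)) ^ n) (f τ) := by
  simp only [HE, HasExpansion, exp_eq_qParam]

theorem HE.add {M : ℕ} {f g : ℍ → ℂ} {p q : PowerSeries ℂ} (hf : HE M f p) (hg : HE M g q) :
    HE M (f + g) (p + q) := by
  rw [HE_iff] at *
  intro τ
  simpa [add_mul] using (hf τ).add (hg τ)

theorem HE.neg {M : ℕ} {f : ℍ → ℂ} {p : PowerSeries ℂ} (hf : HE M f p) :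
    HE M (-f) (-p) := by
  rw [HE_iff] at *
  intro τ
  simpa using (hf τ).neg

theorem HE.const (M : ℕ) (c : ℂ) : HE M (fun _ => c) (PowerSeries.C c) := by
  rw [HE_iff]
  intro τ
  have := hasSum_single (f := fun n : ℕ => PowerSeries.coeff n (PowerSeries.C c) *
      (Function.Periodic.qParam (M : ℝ) (τ : ℂ)) ^ n) 0 (by
    intro n hn; simp [PowerSeries.coeff_C, hn])
  simpa using this

theorem HE.mul {M : ℕ} {f g : ℍ → ℂ} {p q : PowerSeries ℂ} (hf : HE M f p) (hg : HE M g q) :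
    HE M (f * g) (p * q) := by
  rw [HE_iff] at *
  intro τ
  set r := Function.Periodic.qParam (M : ℝ) (τ : ℂ)
  have h1 := (hf τ).summable.norm
  have h2 := (hg τ).summable.norm
  have h3 := tsum_mul_tsum_eq_tsum_sum_antidiagonal_of_summable_norm h1 h2
  have h4 := (summable_norm_sum_mul_antidiagonal_of_summable_norm h1 h2).of_norm
  rw [(hf τ).tsum_eq, (hg τ).tsum_eq] at h3
  have h5 := h4.hasSum
  rw [← h3] at h5
  have h6 : (fun n : ℕ => PowerSeries.coeff n (p * q) * r ^ n) = (fun n : ℕ =>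
      ∑ kl ∈ Finset.HasAntidiagonal.antidiagonal n, PowerSeries.coeff kl.1 p * r ^ kl.1 *
        (PowerSeries.coeff kl.2 q * r ^ kl.2)) := by
   funext n
   rw [PowerSeries.coeff_mul, Finset.sum_mul]
   apply Finset.sum_congr rfl
   intro ij hij
   rw [← Finset.HasAntidiagonal.mem_antidiagonal.1 hij, pow_add]
   ring
  rw [h6]
  exact h5

/-- ring of functions with expansions -/
def expRing (M : ℕ) : Subring ((ℍ → ℂ) × PowerSeries ℂ) where
  carrier := {x | HE M x.1 x.2}
  mul_mem' ha hb := ha.mul hb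
  add_mem' ha hb := ha.add hb
  neg_mem' ha := ha.neg
  one_mem' := by
    have := HE.const M 1
    rw [map_one] at this
    exact this
  zero_mem' := by
    have := HE.const M 0
    rw [map_zero] at this
    exact this

theorem HE.unique_fun {M : ℕ} {f g : ℍ → ℂ} {p : PowerSeries ℂ} (hf : HE M f p) (hg : HE M g p) :
    f = g := by
  funext τ
  exact (hf τ).unique (hg τ)

theorem HE.eq_zero {M : ℕ} (hM : 0 < M) {p : PowerSeries ℂ} (hf : HE M 0 p) : p = 0 := by
  rw [HE_iff] at hf
  have hM' : (0 : ℝ) < M := by exact_mod_cast hM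
  have h0 : cuspFunction (M : ℝ) (0 : ℍ → ℂ) = 0 := by
    rw [cuspFunction, show (0 : ℍ → ℂ) ∘ ofComplex = 0 from rfl]
    funext w
    rcases eq_or_ne w 0 with rfl | h
    · exact Function.Periodic.cuspFunction_zero_of_zero_at_inf hM'
        (by unfold Filter.ZeroAtFilter; exact tendsto_const_nhds)
    · rw [Function.Periodic.cuspFunction_eq_of_nonzero _ _ h]; rfl
  have h := hasFPowerSeriesOnBall_cuspFunction (h := (M : ℝ)) (f := (0 : ℍ → ℂ))
    (c := fun n => PowerSeries.coeff n p) hM' (by rw [h0]; exact analyticAt_const)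
    (by simpa using hf)
  rw [h0] at h
  have h2 := h.hasFPowerSeriesAt.eq_zero
  rw [FormalMultilinearSeries.ofScalars_series_eq_zero] at h2
  ext n
  exact congrFun h2 n

theorem HE.unique {M : ℕ} (hM : 0 < M) {f : ℍ → ℂ} {p q : PowerSeries ℂ} (hf : HE M f p)
    (hg : HE M f q) : p = q := by
  have := hf.add hg.neg
  rw [add_neg_cancel] at this
  have := this.eq_zero hM
  rw [← sub_eq_add_neg] at this
  exact sub_eq_zero.1 this

theorem HE.bdd {M : ℕ} (hM : 0 < M) {f : ℍ → ℂ} {p : PowerSeries ℂ} (hf : HE M f p) :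
    IsBoundedAtImInfty f := by
  rw [HE_iff] at hf
  exact isBoundedAtImInfty_of_hasSum_qExpansion (h := (M : ℝ)) (by exact_mod_cast hM)
    (by simpa using hf)

theorem HE.mdiff {M : ℕ} (hM : 0 < M) {f : ℍ → ℂ} {p : PowerSeries ℂ} (hf : HE M f p) :
    MDifferentiable (modelWithCornersSelf ℂ ℂ) (modelWithCornersSelf ℂ ℂ) f := by
  rw [HE_iff] at hf
  have hM' : (0 : ℝ) < M := by exact_mod_cast hM
  let c : ℕ → ℂ := fun n => PowerSeries.coeff n p
  let ps := FormalMultilinearSeries.ofScalars ℂ c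
  have hrad : 1 ≤ ps.radius := by
    refine le_of_forall_lt_imp_le_of_dense fun r hr ↦ ?_
    rcases eq_or_ne r 0 with rfl | hr'
    · simp
    lift r to NNReal using hr.ne_top
    apply FormalMultilinearSeries.le_radius_of_summable
    have hq : ‖(r : ℂ)‖ < 1 := by simpa using! hr
    have hq1 : (r : ℂ) ≠ 0 := by simpa using! hr'
    have h1 := Function.Periodic.im_invQParam_pos_of_norm_lt_one hM' hq hq1
    have h2 := (hf ⟨_, h1⟩).summable.norm
    simp only [UpperHalfPlane.coe_mk, Function.Periodic.qParam_right_inv hM'.ne' hq1] at h2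
    refine h2.congr fun n => ?_
    simp [ps, c, FormalMultilinearSeries.ofScalars_norm]
  have hps := ps.hasFPowerSeriesOnBall (lt_of_lt_of_le one_pos hrad)
  have hd : DifferentiableOn ℂ ps.sum (Metric.ball 0 1) := by
    have := hps.differentiableOn.mono (Metric.eball_subset_eball hrad)
    convert! this
    ext; simp [enorm, ← NNReal.coe_lt_coe]
  rw [UpperHalfPlane.mdifferentiable_iff]
  have hc : ∀ τ : ℍ, f τ = ps.sum (Function.Periodic.qParam (M : ℝ) (τ : ℂ)) := by
    intro τ
    rw [← (hf τ).tsum_eq]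
    simp [ps, FormalMultilinearSeries.sum, c, mul_comm]
  have : DifferentiableOn ℂ (fun z => ps.sum (Function.Periodic.qParam (M : ℝ) z)) {z | 0 < z.im} := by
    refine hd.comp Function.Periodic.differentiable_qParam.differentiableOn ?_
    intro z hz
    simpa using Function.Periodic.norm_qParam_lt_one hM' hz
  refine this.congr fun z hz => ?_
  simp [hc, ofComplex_apply_of_im_pos hz]

/-- change of level -/
def expandPS (m : ℕ) (p : PowerSeries ℂ) : PowerSeries ℂ :=
  PowerSeries.mk fun n => if m ∣ n then PowerSeries.coeff (n / m) p else 0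

theorem HE.expand {M m : ℕ} (hm : 0 < m) (hM : 0 < M) {f : ℍ → ℂ} {p : PowerSeries ℂ} (hf : HE M f p) :
    HE (M * m) f (expandPS m p) := by
  rw [HE_iff] at *
  intro τ
  have h := hf τ
  have hinj : Function.Injective (fun n : ℕ => m * n) := fun a b h => Nat.eq_of_mul_eq_mul_left hm h
  rw [← hinj.hasSum_iff]
  · convert h using 2 with n
    simp only [expandPS, Function.comp, PowerSeries.coeff_mk, dvd_mul_right, if_true,
      Nat.mul_div_cancel_left _ hm]
    congr 1
    rw [pow_mul]
    congr 1
    rw [Function.Periodic.qParam, Function.Periodic.qParam, ← Complex.exp_nat_mul]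
    congr 1
    push_cast
    have : (M : ℂ) ≠ 0 := by exact_mod_cast hM.ne'
    have : (m : ℂ) ≠ 0 := by exact_mod_cast hm.ne'
    field_simp
  · intro n hn
    have : ¬ m ∣ n := fun ⟨c, hc⟩ => hn ⟨c, hc.symm⟩
    simp [expandPS, this]

theorem expandPS_map (m : ℕ) (σ : ℂ →+* ℂ) (p : PowerSeries ℂ) :
    PowerSeries.map σ (expandPS m p) = expandPS m (PowerSeries.map σ p) := by
  ext n
  simp only [expandPS, PowerSeries.coeff_map, PowerSeries.coeff_mk]
  split_ifs <;> simp

theorem expandPS_inj {m : ℕ} (hm : 0 < m) {p q : PowerSeries ℂ} (h : expandPS m p = expandPS m q) :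
    p = q := by
  ext n
  have := congrArg (PowerSeries.coeff (m * n)) h
  simpa [expandPS, hm.ne', hm] using this

theorem HE_levelOne {w : ℤ} (g : ModularForm 𝒮ℒ w) : HE 1 g (qExpansion 1 g) := by
  rw [HE_iff]
  intro τ
  have := ModularForm.hasSum_qExpansion g one_pos one_mem_strictPeriods_SL τ
  simpa using this

theorem HE.smul {M : ℕ} {f : ℍ → ℂ} {p : PowerSeries ℂ} (hf : HE M f p) (c : ℂ) :
    HE M (c • f) (PowerSeries.C c * p) := by
  have := (HE.const M c).mul hf
  exact this

theorem HE.sub {M : ℕ} {f g : ℍ → ℂ} {p q : PowerSeries ℂ} (hf : HE M f p) (hg : HE M g q) :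
    HE M (f - g) (p - q) := by
  rw [sub_eq_add_neg, sub_eq_add_neg]; exact hf.add hg.neg

theorem HE.pow {M : ℕ} {f : ℍ → ℂ} {p : PowerSeries ℂ} (hf : HE M f p) (n : ℕ) :
    HE M (f ^ n) (p ^ n) :=
  (pow_mem (show ((f, p) : (ℍ → ℂ) × PowerSeries ℂ) ∈ expRing M from hf) n : _)

theorem E_fixed (σ : ℂ →+* ℂ) {k : ℕ} (hk : 3 ≤ k) (hk2 : Even k) :
    PowerSeries.map σ (qExpansion 1 (ModularForm.E hk)) = qExpansion 1 (ModularForm.E hk) := by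
  ext m
  rw [PowerSeries.coeff_map, EisensteinSeries.E_qExpansion_coeff hk hk2]
  split_ifs <;> simp [map_ofNat]

theorem disc_HE_fixed (σ : ℂ →+* ℂ) : ∃ p : PowerSeries ℂ, HE 1 ModularForm.discriminant p ∧
    PowerSeries.map σ p = p := by
  have h4 := (HE_levelOne ModularForm.E₄).pow 3
  have h6 := (HE_levelOne ModularForm.E₆).pow 2
  have := (h4.sub h6).smul (1728⁻¹)
  refine ⟨PowerSeries.C 1728⁻¹ * ((qExpansion 1 ModularForm.E₄) ^ 3 - (qExpansion 1 ModularForm.E₆) ^ 2), ?_, ?_⟩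
  · convert! this using 1
    funext z
    simp [ModularForm.discriminant_eq_E₄_cube_sub_E₆_sq]
    ring
  · rw [map_mul, map_sub, map_pow, map_pow, E_fixed σ _ ⟨2, rfl⟩, E_fixed σ _ ⟨3, rfl⟩]
    rw [PowerSeries.map_C, map_inv₀, map_ofNat]

theorem gal1_aux (σ : ℂ →+* ℂ) (n : ℕ) : ∀ (w : ℤ) (_ : w < n) (g : ModularForm 𝒮ℒ w)
    (p : PowerSeries ℂ) (_ : HE 1 g p),
    ∃ g' : ModularForm 𝒮ℒ w, HE 1 g' (PowerSeries.map σ p) := by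
  induction n with
  | zero =>
    intro w hw g p hp
    rw [ModularFormClass.levelOne_neg_weight_eq_zero (by simpa using hw) g] at hp
    rw [hp.eq_zero one_pos]
    exact ⟨0, by rw [map_zero]; exact (expRing 1).zero_mem⟩
  | succ n ih =>
    intro w hw g p hp
    have hz : (⇑g = 0) → ∃ g' : ModularForm 𝒮ℒ w, HE 1 g' (PowerSeries.map σ p) := by
      intro h
      rw [h] at hp
      rw [hp.eq_zero one_pos]
      exact ⟨0, by rw [map_zero]; exact (expRing 1).zero_mem⟩
    rcases lt_or_ge w 0 with hw0 | hw0
    · exact hz (ModularFormClass.levelOne_neg_weight_eq_zero hw0 g)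
    rcases Int.even_or_odd w with hev | hodd
    swap
    · exact hz (by rw [ModularForm.levelOne_odd_weight_eq_zero hodd g]; rfl)
    obtain ⟨K, rfl⟩ := Int.eq_ofNat_of_zero_le hw0
    rw [Int.even_coe_nat] at hev
    rcases lt_or_ge K 3 with hK | hK
    · have : K = 0 ∨ K = 2 := by
        obtain ⟨r, rfl⟩ := hev; omega
      rcases this with rfl | rfl
      · obtain ⟨c, hc⟩ := ModularFormClass.levelOne_weight_zero_const g
        rw [hc] at hp
        rw [hp.unique one_pos (HE.const 1 c)]
        refine ⟨ModularForm.const (σ c), ?_⟩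
        rw [PowerSeries.map_C]
        exact HE.const 1 (σ c)
      · apply hz
        have h1 := ModularForm.levelOne_weight_two_rank_zero
        rw [rank_zero_iff_forall_zero] at h1
        rw [h1 g]; rfl
    · have hE0 := EisensteinSeries.E_qExpansion_coeff_zero hK hev
      have hp' := hp.unique one_pos (HE_levelOne g)
      let a := PowerSeries.coeff 0 p
      let g0 : ModularForm 𝒮ℒ K := g - a • ModularForm.E hK
      have hg0 : HE 1 g0 (p - PowerSeries.C a * qExpansion 1 (ModularForm.E hK)) :=
        hp.sub ((HE_levelOne (ModularForm.E hK)).smul a)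
      have hc0 : (qExpansion 1 g0).coeff 0 = 0 := by
        rw [← hg0.unique one_pos (HE_levelOne g0)]
        simp only [map_sub, PowerSeries.coeff_C_mul, hE0, a]
        simp
      let h := CuspForm.discriminantEquiv (ModularForm.toCuspForm g0 hc0)
      obtain ⟨d, hd, hdσ⟩ := disc_HE_fixed σ
      have hh := HE_levelOne h
      have heq : (ModularForm.discriminant * ⇑h) = ⇑g0 :=
        ModularForm.discriminant_mul_discriminantEquiv (ModularForm.toCuspForm g0 hc0)
      have h1 := hd.mul hh
      rw [heq] at h1
      have h2 := h1.unique one_pos hg0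
      obtain ⟨h', hh'⟩ := ih ((K : ℤ) - 12) (by push_cast at hw; omega) h _ hh
      obtain ⟨D, hD⟩ : ∃ D : ModularForm 𝒮ℒ 12, ⇑D = ModularForm.discriminant :=
        ⟨(CuspForm.discriminant : ModularForm 𝒮ℒ 12), rfl⟩
      refine ⟨ModularForm.mcast (by ring) (D.mul h') + (σ a) • ModularForm.E hK, ?_⟩
      have h3 := (hd.mul hh').add ((HE_levelOne (ModularForm.E hK)).smul (σ a))
      have h4 : p = d * qExpansion 1 h + PowerSeries.C a * qExpansion 1 (ModularForm.E hK) := by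
        rw [h2]; ring
      rw [h4, map_add, map_mul, map_mul, hdσ, PowerSeries.map_C, E_fixed σ hK hev]
      rw [← hD] at h3
      exact h3

theorem gal1 (σ : ℂ →+* ℂ) {w : ℤ} (g : ModularForm 𝒮ℒ w)
    {p : PowerSeries ℂ} (hp : HE 1 g p) :
    ∃ g' : ModularForm 𝒮ℒ w, HE 1 g' (PowerSeries.map σ p) :=
  gal1_aux σ (w.toNat + 1) w (by omega) g p hp

/-- normalising constant -/
def C3 : ℂ := (-2 * Real.pi * Complex.I) ^ (2 + 1) / Nat.factorial 2

theorem C3_ne : C3 ≠ 0 := by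
  unfold C3
  have : (Real.pi : ℂ) ≠ 0 := by exact_mod_cast Real.pi_ne_zero
  simp [this, Nat.factorial]

/-- additive character -/
def chi (M : ℕ) [NeZero M] (a : ZMod M) : ℂ := ZMod.stdAddChar a

theorem chi_add (M : ℕ) [NeZero M] (a b : ZMod M) : chi M (a + b) = chi M a * chi M b :=
  AddChar.map_add_eq_mul _ _ _

theorem chi_natmul (M : ℕ) [NeZero M] (n : ℕ) (b : ZMod M) : chi M (n * b) = chi M b ^ n := by
  unfold chi
  rw [← nsmul_eq_mul, AddChar.map_nsmul_eq_pow]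

theorem chi_coe (M : ℕ) [NeZero M] (j : ℤ) :
    chi M (j : ZMod M) = Complex.exp (2 * Real.pi * Complex.I * j / M) := ZMod.stdAddChar_coe j

theorem chi_norm (M : ℕ) [NeZero M] (a : ZMod M) : ‖chi M a‖ = 1 := by
  unfold chi
  exact Circle.norm_coe _

theorem row_sum (M : ℕ) [NeZero M] (b : ZMod M) (z : ℍ) :
    (∑' d : ℤ, if (d : ZMod M) = b then ((z : ℂ) + d) ^ (-3 : ℤ) else 0) =
     C3 / M ^ 3 * ∑' n : ℕ+, (n : ℂ) ^ 2 * chi M (n * b) *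
        Function.Periodic.qParam (M : ℝ) z ^ (n : ℕ) := by
  have hM : (M : ℂ) ≠ 0 := by exact_mod_cast NeZero.ne M
  have hM0 : (0 : ℝ) < M := by exact_mod_cast Nat.pos_of_ne_zero (NeZero.ne M)
  let g : ℤ → ℤ := fun m => b.val + M * m
  have hg : Function.Injective g := by
    intro x y h
    have : (M : ℤ) * x = M * y := by simpa [g] using h
    exact mul_left_cancel₀ (by exact_mod_cast NeZero.ne M) this
  have hb : ((b.val : ℤ) : ZMod M) = b := by simp
  rw [← hg.tsum_eq]
  swap
  · intro d hd
    have hd' : (d : ZMod M) = b := by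
      by_contra h; simp [h] at hd
    rw [← hb, ZMod.intCast_eq_intCast_iff_dvd_sub] at hd'
    obtain ⟨c, hc⟩ := hd'
    refine ⟨-c, ?_⟩
    simp only [g]
    linarith
  have him : 0 < (((z : ℂ) + b.val) / M).im := by
    have : ((z : ℂ) + b.val) / M = ((M⁻¹ : ℝ) : ℂ) * ((z : ℂ) + b.val) := by
      push_cast; field_simp
    rw [this, Complex.im_ofReal_mul]
    have := z.im_pos
    have h3 : ((z : ℂ) + b.val).im = z.im := by
      rw [Complex.add_im, Complex.natCast_im, add_zero]; rfl
    rw [h3]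
    positivity
  let z' : ℍ := ⟨((z : ℂ) + b.val) / M, him⟩
  have h1 := EisensteinSeries.qExpansion_identity_pnat (k := 2) (by norm_num) z'
  have h2 : ∀ m : ℤ, (if ((g m : ℤ) : ZMod M) = b then ((z : ℂ) + (g m : ℤ)) ^ (-3 : ℤ) else 0)
      = ((M : ℂ) ^ 3)⁻¹ * (1 / ((z' : ℂ) + m) ^ (2 + 1)) := by
    intro m
    rw [if_pos (by simp [g])]
    have : (z : ℂ) + (g m : ℤ) = M * ((z' : ℂ) + m) := by
      simp only [z', g]
      push_cast
      field_simp
      ring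
    rw [this, mul_zpow, zpow_neg, zpow_neg]
    norm_cast
    simp
  rw [tsum_congr h2, tsum_mul_left, h1, ← mul_assoc]
  congr 1
  · rw [C3]; push_cast; ring
  · refine tsum_congr fun n => ?_
    rw [mul_assoc ((n : ℂ) ^ 2)]
    congr 1
    have : ((n : ℕ) : ZMod M) * b = (((n : ℕ) * b.val : ℤ) : ZMod M) := by
      push_cast; simp
    rw [show ((n : ℕ) : ZMod M) * b = (((n : ℕ) * b.val : ℤ) : ZMod M) from this, chi_coe,
      Function.Periodic.qParam.eq_def, ← Complex.exp_nat_mul, ← Complex.exp_nat_mul, ← Complex.exp_add]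
    congr 1
    simp only [z']
    push_cast
    ring

theorem chi_orth (M : ℕ) [NeZero M] (c : ZMod M) :
    ∑ a : ZMod M, chi M (a * c) = if c = 0 then (M : ℂ) else 0 := by
  have := AddChar.sum_mulShift (ψ := (ZMod.stdAddChar : AddChar (ZMod M) ℂ)) c
    (ZMod.isPrimitive_stdAddChar M)
  simpa [chi, ZMod.card] using this

/-- constant term -/
def kap (M : ℕ) [NeZero M] (b : ZMod M) : ℂ :=
  (1 / (3 * M)) * ∑ a : ZMod M, chi M (-(a * b)) * ((bernoulliFun 3 ((a.val : ℝ) / M) : ℝ) : ℂ)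

theorem bern_rat (M j : ℕ) : ∃ r : ℚ, bernoulliFun 3 ((j : ℝ) / M) = r := by
  refine ⟨(Polynomial.bernoulli 3).eval ((j : ℚ) / M), ?_⟩
  rw [bernoulliFun]
  have : ((j : ℝ) / M) = algebraMap ℚ ℝ ((j : ℚ) / M) := by simp
  rw [this, Polynomial.eval_map_algebraMap, Polynomial.aeval_algebraMap_apply]
  simp

theorem const_sum (M : ℕ) [NeZero M] (b : ZMod M) :
    (∑' d : ℤ, if (d : ZMod M) = b then ((d : ℂ)) ^ (-3 : ℤ) else 0) = C3 * kap M b := by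
  have hM : (M : ℂ) ≠ 0 := by exact_mod_cast NeZero.ne M
  have hM0 : (0 : ℝ) < M := by exact_mod_cast Nat.pos_of_ne_zero (NeZero.ne M)
  have hs : Summable (fun d : ℤ => if (d : ZMod M) = b then ((d : ℂ)) ^ (-3 : ℤ) else 0) := by
    refine Summable.of_norm_bounded
      (g := fun d : ℤ => |1 / (d : ℝ) ^ 3|) ((Real.summable_one_div_int_pow (p := 3)).2 (by norm_num)).abs ?_
    intro d
    split_ifs
    · rw [norm_zpow, zpow_neg]
      simp only [Complex.norm_intCast, one_div, abs_inv, abs_pow]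
      norm_cast
    · simp
  have h1 := hs.hasSum.nat_add_neg
  have h2 : HasSum (fun n : ℕ => ∑ a : ZMod M, (1 / (M : ℂ) * chi M (-(a * b))) *
      ((1 : ℂ) / (n : ℂ) ^ 3 * (fourier n (((a.val : ℝ) / M : ℝ) : UnitAddCircle)
        + (-1 : ℂ) ^ 3 * fourier (-n) (((a.val : ℝ) / M : ℝ) : UnitAddCircle))))
      (∑ a : ZMod M, (1 / (M : ℂ) * chi M (-(a * b))) *
        (-(2 * Real.pi * Complex.I) ^ 3 / (Nat.factorial 3 : ℂ) *
          ((bernoulliFun 3 ((a.val : ℝ) / M) : ℝ) : ℂ))) := by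
    refine hasSum_sum fun a _ => HasSum.mul_left _ ?_
    refine hasSum_one_div_nat_pow_mul_fourier (by norm_num) ⟨by positivity, ?_⟩
    rw [div_le_one hM0]
    exact_mod_cast (ZMod.val_lt a).le
  have hf : ∀ (n : ℤ) (a : ZMod M), fourier n (((a.val : ℝ) / M : ℝ) : UnitAddCircle)
      = chi M (n * a) := by
    intro n a
    rw [fourier_coe_apply]
    have : (n : ZMod M) * a = ((n * a.val : ℤ) : ZMod M) := by push_cast; simp
    rw [this, chi_coe]
    congr 1
    push_cast
    field_simp
  have h3 : ∀ n : ℕ, ∑ a : ZMod M, (1 / (M : ℂ) * chi M (-(a * b))) *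
      ((1 : ℂ) / (n : ℂ) ^ 3 * (fourier n (((a.val : ℝ) / M : ℝ) : UnitAddCircle)
        + (-1 : ℂ) ^ 3 * fourier (-n) (((a.val : ℝ) / M : ℝ) : UnitAddCircle))) =
      (fun d : ℤ => if (d : ZMod M) = b then ((d : ℂ)) ^ (-3 : ℤ) else 0) n +
      (fun d : ℤ => if (d : ZMod M) = b then ((d : ℂ)) ^ (-3 : ℤ) else 0) (-n) := by
    intro n
    have h4 : ∀ a : ZMod M, (1 / (M : ℂ) * chi M (-(a * b))) *
      ((1 : ℂ) / (n : ℂ) ^ 3 * (fourier n (((a.val : ℝ) / M : ℝ) : UnitAddCircle)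
        + (-1 : ℂ) ^ 3 * fourier (-n) (((a.val : ℝ) / M : ℝ) : UnitAddCircle))) =
        (1 / (M : ℂ) * ((1 : ℂ) / (n : ℂ) ^ 3)) *
          (chi M (a * (((n : ℤ) : ZMod M) - b)) - chi M (a * (((-n : ℤ) : ZMod M) - b))) := by
      intro a
      have e : ∀ c : ZMod M, chi M (a * (c - b)) = chi M (a * c) * chi M (-(a * b)) := by
        intro c
        rw [← chi_add]; congr 1; ring
      rw [hf, hf, e, e,
        mul_comm a ((n : ℤ) : ZMod M), mul_comm a ((-n : ℤ) : ZMod M)]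
      ring
    rw [Finset.sum_congr rfl fun a _ => h4 a, ← Finset.mul_sum, Finset.sum_sub_distrib, chi_orth,
      chi_orth]
    simp only [sub_eq_zero]
    have e1 : ((n : ℤ) : ℂ) ^ (-3 : ℤ) = 1 / (n : ℂ) ^ 3 := by
      rw [zpow_neg]; norm_cast; simp
    have e2 : ((-n : ℤ) : ℂ) ^ (-3 : ℤ) = - (1 / (n : ℂ) ^ 3) := by
      rw [zpow_neg]
      have : (((-n : ℤ) : ℂ)) ^ (3 : ℤ) = -((n : ℂ) ^ 3) := by
        rw [show (3 : ℤ) = ((3 : ℕ) : ℤ) from rfl, zpow_natCast]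
        push_cast; ring
      rw [this]; simp
    rw [e1, e2]
    split_ifs <;> field_simp <;> ring
  have h5 : (fun n : ℕ => ∑ a : ZMod M, (1 / (M : ℂ) * chi M (-(a * b))) *
      ((1 : ℂ) / (n : ℂ) ^ 3 * (fourier n (((a.val : ℝ) / M : ℝ) : UnitAddCircle)
        + (-1 : ℂ) ^ 3 * fourier (-n) (((a.val : ℝ) / M : ℝ) : UnitAddCircle)))) = _ := funext h3
  rw [h5] at h2
  have h6 := h1.unique h2
  simp only [Int.cast_zero] at h6
  rw [zero_zpow _ (by norm_num), ite_self, add_zero] at h6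
  rw [h6, kap, C3, Finset.mul_sum, Finset.mul_sum]
  refine Finset.sum_congr rfl fun a _ => ?_
  simp only [Nat.factorial]
  push_cast
  field_simp
  ring

theorem hasSum_div {A : ℕ → ℕ → ℂ} {q t : ℂ} (c0 : ℂ)
    (h : HasSum (fun x : ℕ+ × ℕ+ => A x.1 x.2 * q ^ ((x.1 : ℕ) * (x.2 : ℕ))) t) :
    HasSum (fun m : ℕ => (if m = 0 then c0 else ∑ x ∈ Nat.divisorsAntidiagonal m, A x.1 x.2) * q ^ m)
      (c0 + t) := by
  have h1 := sigmaAntidiagonalEquivProd.hasSum_iff.2 h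
  have h2 := h1.sigma (fun n => hasSum_fintype _)
  have h3 : HasSum (fun n : ℕ+ => (∑ x ∈ Nat.divisorsAntidiagonal n, A x.1 x.2) * q ^ (n : ℕ)) t := by
    convert! h2 using 2 with n
    rw [Finset.sum_mul, ← Finset.sum_coe_sort]
    refine Finset.sum_congr rfl fun x _ => ?_
    have : (x.1.1 * x.1.2) = n := (Nat.mem_divisorsAntidiagonal.1 x.2).1
    simp [sigmaAntidiagonalEquivProd, divisorsAntidiagonalFactors, this]
  have h4 : HasSum (fun m : ℕ => if m = 0 then 0 else
      (∑ x ∈ Nat.divisorsAntidiagonal m, A x.1 x.2) * q ^ m) t := by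
    rw [← PNat.coe_injective.hasSum_iff]
    · convert! h3 using 2 with n
      simp
    · intro m hm
      have : m = 0 := by
        by_contra h
        exact hm ⟨⟨m, Nat.pos_of_ne_zero h⟩, rfl⟩
      simp [this]
  convert! (hasSum_ite_eq 0 c0).add h4 using 2 with m
  split_ifs with h <;> simp [h]

/-- coefficient function -/
def eA (M : ℕ) [NeZero M] (v : Fin 2 → ZMod M) (c n : ℕ) : ℂ :=
  (n : ℂ) ^ 2 * ((if (c : ZMod M) = v 0 then chi M (n * v 1) else 0) -
    (if (c : ZMod M) = - v 0 then chi M (n * (- v 1)) else 0))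

/-- expansions -/
def eU (M : ℕ) [NeZero M] (v : Fin 2 → ZMod M) : PowerSeries ℂ :=
  PowerSeries.mk fun m => if m = 0 then (M : ℂ) ^ 3 * (if v 0 = 0 then kap M (v 1) else 0) else
    ∑ x ∈ Nat.divisorsAntidiagonal m, eA M v x.1 x.2

/-- summand -/
def eF (M : ℕ) (v : Fin 2 → ZMod M) (τ : ℍ) (i : Fin 2 → ℤ) : ℂ :=
  if (i 0 : ZMod M) = v 0 ∧ (i 1 : ZMod M) = v 1 then EisensteinSeries.eisSummand 3 i τ else 0

/-- Eisenstein series -/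
def eG (M : ℕ) (v : Fin 2 → ZMod M) (τ : ℍ) : ℂ := (M : ℂ) ^ 3 / C3 * ∑' i, eF M v τ i

theorem eF_summable (M : ℕ) (v : Fin 2 → ZMod M) (τ : ℍ) : Summable (eF M v τ) := by
  refine Summable.of_norm_bounded (EisensteinSeries.summable_norm_eisSummand (le_refl 3) τ) ?_
  intro i
  unfold eF
  split_ifs
  · exact le_rfl
  · simp

theorem eA_norm (M : ℕ) [NeZero M] (v : Fin 2 → ZMod M) (c n : ℕ) :
    ‖eA M v c n‖ ≤ 2 * (n : ℝ) ^ 2 := by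
  unfold eA
  rw [norm_mul, norm_pow, Complex.norm_natCast, mul_comm]
  gcongr
  refine (norm_sub_le _ _).trans ?_
  have : ∀ (p : Prop) [Decidable p] (a : ZMod M), ‖if p then chi M a else 0‖ ≤ 1 := by
    intro p _ a
    split_ifs <;> simp [chi_norm]
  linarith [this ((c : ZMod M) = v 0) (n * v 1), this ((c : ZMod M) = - v 0) (n * (- v 1))]

theorem eA_summable (M : ℕ) [NeZero M] (v : Fin 2 → ZMod M) {q : ℂ} (hq : ‖q‖ < 1) :
    Summable (fun x : ℕ+ × ℕ+ => eA M v x.1 x.2 * q ^ ((x.1 : ℕ) * (x.2 : ℕ))) := by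
  have := (summable_prod_mul_pow 2 hq).norm.mul_left 2
  refine Summable.of_norm_bounded this ?_
  intro x
  rw [norm_mul, norm_mul, ← mul_assoc]
  gcongr
  refine (eA_norm M v _ _).trans ?_
  simp

/-- row -/
def eR (M : ℕ) (v : Fin 2 → ZMod M) (τ : ℍ) (c : ℤ) : ℂ := ∑' d : ℤ, eF M v τ ![c, d]

theorem eR_zero (M : ℕ) [NeZero M] (v : Fin 2 → ZMod M) (τ : ℍ) :
    eR M v τ 0 = C3 * if v 0 = 0 then kap M (v 1) else 0 := by
  unfold eR eF
  by_cases h : v 0 = 0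
  · rw [if_pos h, ← const_sum]
    refine tsum_congr fun d => ?_
    simp [h, EisensteinSeries.eisSummand]
  · have h' : ¬ (0 = v 0) := fun h' => h h'.symm
    simp [h, h']

theorem eR_pos (M : ℕ) [NeZero M] (v : Fin 2 → ZMod M) (τ : ℍ) (c : ℕ+) :
    eR M v τ (c : ℕ) = C3 / M ^ 3 * ∑' n : ℕ+, (n : ℂ) ^ 2 *
      (if ((c : ℕ) : ZMod M) = v 0 then chi M (n * v 1) else 0) *
      Function.Periodic.qParam (M : ℝ) τ ^ ((c : ℕ) * (n : ℕ)) := by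
  unfold eR eF
  by_cases h : ((c : ℕ) : ZMod M) = v 0
  · have him : 0 < ((c : ℂ) * τ).im := by
      have := τ.im_pos
      have h1 : ((c : ℂ) * τ).im = c * τ.im := by
        have : (c : ℂ) = ((c : ℝ) : ℂ) := by simp
        rw [this, Complex.im_ofReal_mul]; rfl
      rw [h1]
      positivity
    have := row_sum M (v 1) ⟨(c : ℂ) * τ, him⟩
    convert! this using 1
    · refine tsum_congr fun d => ?_
      simp [h, EisensteinSeries.eisSummand]
    · congr 1
      refine tsum_congr fun n => ?_
      rw [if_pos h, pow_mul]
      congr 2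
      rw [Function.Periodic.qParam, Function.Periodic.qParam, ← Complex.exp_nat_mul]
      congr 1
      push_cast
      ring
  · simp [h]

theorem eF_pair (M : ℕ) (v : Fin 2 → ZMod M) (τ : ℍ) (c d : ℤ) : eF M v τ ![c, d] =
    if (c : ZMod M) = v 0 ∧ (d : ZMod M) = v 1 then ((c : ℂ) * τ + d) ^ (-3 : ℤ) else 0 := rfl

theorem eR_neg (M : ℕ) [NeZero M] (v : Fin 2 → ZMod M) (τ : ℍ) (c : ℕ+) :
    eR M v τ (-(c : ℕ)) = - eR M (-v) τ (c : ℕ) := by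
  unfold eR
  rw [← (Equiv.neg ℤ).tsum_eq, ← tsum_neg]
  refine tsum_congr fun d => ?_
  rw [Equiv.neg_apply, eF_pair, eF_pair]
  have e1 : ((-(c : ℕ) : ℤ) : ZMod M) = v 0 ↔ (((c : ℕ) : ℤ) : ZMod M) = - v 0 := by
    push_cast; exact neg_eq_iff_eq_neg
  have e2 : ((-d : ℤ) : ZMod M) = v 1 ↔ (d : ZMod M) = - v 1 := by
    push_cast; exact neg_eq_iff_eq_neg
  by_cases hh : (((c : ℕ) : ℤ) : ZMod M) = (-v) 0 ∧ (d : ZMod M) = (-v) 1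
  swap
  · rw [if_neg hh, if_neg (fun h => hh ⟨e1.1 h.1, e2.1 h.2⟩), neg_zero]
  · rw [if_pos hh, if_pos ⟨e1.2 hh.1, e2.2 hh.2⟩]
    have : (((-(c : ℕ) : ℤ) : ℂ) * τ + ((-d : ℤ) : ℂ)) = -1 * ((((c : ℕ) : ℤ) : ℂ) * τ + d) := by
      push_cast; ring
    rw [this, mul_zpow]
    norm_num

theorem half_summable (M : ℕ) [NeZero M] {q : ℂ} (hq : ‖q‖ < 1) (p : Prop) [Decidable p]
    (c : ℕ+) (b : ZMod M) : Summable (fun n : ℕ+ => (n : ℂ) ^ 2 *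
      (if p then chi M (n * b) else 0) * q ^ ((c : ℕ) * (n : ℕ))) := by
  refine Summable.of_norm_bounded ((summable_prod_mul_pow 2 hq).prod_factor c).norm ?_
  intro n
  rw [norm_mul, norm_mul, norm_mul]
  have : ‖if p then chi M (n * b) else 0‖ ≤ 1 := by split_ifs <;> simp [chi_norm]
  have h2 := mul_le_mul_of_nonneg_left this (norm_nonneg ((n : ℂ) ^ 2))
  rw [mul_one] at h2
  gcongr

theorem eG_HE (M : ℕ) [NeZero M] (v : Fin 2 → ZMod M) : HE M (eG M v) (eU M v) := by
  have hM : (M : ℂ) ≠ 0 := by exact_mod_cast NeZero.ne M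
  have hM0 : (0 : ℝ) < M := by exact_mod_cast Nat.pos_of_ne_zero (NeZero.ne M)
  rw [HE_iff]
  intro τ
  set q := Function.Periodic.qParam (M : ℝ) (τ : ℂ) with hqdef
  have hq : ‖q‖ < 1 := Function.Periodic.norm_qParam_lt_one hM0 τ.im_pos
  have hs := (finTwoArrowEquiv ℤ).symm.summable_iff.2 (eF_summable M v τ)
  have h1 : HasSum (fun c : ℤ => eR M v τ c) (∑' i, eF M v τ i) := by
    rw [← (finTwoArrowEquiv ℤ).symm.tsum_eq]
    exact hs.hasSum.prod_fiberwise (fun c => (hs.prod_factor c).hasSum)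
  have h2 := h1.nat_add_neg
  have h3 := (hasSum_nat_add_iff' 1).2 h2
  have h4 : HasSum (fun c : ℕ+ => eR M v τ (c : ℕ) + eR M v τ (-(c : ℕ)))
      (∑' i, eF M v τ i - eR M v τ 0) := by
    rw [← Equiv.pnatEquivNat.symm.hasSum_iff]
    convert! h3 using 1
    · simp
  have h5 : ∀ c : ℕ+, eR M v τ (c : ℕ) + eR M v τ (-(c : ℕ)) =
      C3 / M ^ 3 * ∑' n : ℕ+, eA M v c n * q ^ ((c : ℕ) * (n : ℕ)) := by
    intro c
    rw [eR_neg, eR_pos, eR_pos, ← sub_eq_add_neg, ← mul_sub, ← Summable.tsum_sub]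
    · congr 1
      refine tsum_congr fun n => ?_
      simp only [eA, Pi.neg_apply]
      ring
    · exact half_summable M hq _ _ _
    · exact half_summable M hq _ _ _
  simp only [h5] at h4
  have hT := eA_summable M v hq
  have h6 := hT.hasSum.prod_fiberwise (fun c => (hT.prod_factor c).hasSum)
  have h7 := (h6.mul_left (C3 / M ^ 3)).unique h4
  have h8 := hasSum_div ((M : ℂ) ^ 3 * (if v 0 = 0 then kap M (v 1) else 0)) hT.hasSum
  convert! h8 using 1
  · simp [eU]
  · rw [eR_zero] at h7
    rw [eG]
    have := C3_ne
    field_simp at h7 ⊢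
    linear_combination -h7

/-- right action on row vectors -/
def va {M : ℕ} (v : Fin 2 → ZMod M) (γ : SL(2, ℤ)) : Fin 2 → ZMod M :=
  fun j => v 0 * ((γ 0 j : ℤ) : ZMod M) + v 1 * ((γ 1 j : ℤ) : ZMod M)

theorem va_mul {M : ℕ} (v : Fin 2 → ZMod M) (γ γ' : SL(2, ℤ)) :
    va (va v γ) γ' = va v (γ * γ') := by
  funext j
  simp only [va, Matrix.SpecialLinearGroup.coe_mul, Matrix.mul_apply, Fin.sum_univ_two]
  push_cast
  ring

theorem va_one {M : ℕ} (v : Fin 2 → ZMod M) : va v 1 = v := by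
  funext j
  fin_cases j <;> simp [va]

theorem va_inj {M : ℕ} {v w : Fin 2 → ZMod M} (γ : SL(2, ℤ)) (h : va v γ = va w γ) : v = w := by
  have := congrArg (fun x => va x γ⁻¹) h
  simpa [va_mul, va_one] using this

theorem va_cop {M : ℕ} {v : Fin 2 → ZMod M} (h : IsCoprime (v 0) (v 1)) (γ : SL(2, ℤ)) :
    IsCoprime (va v γ 0) (va v γ 1) := by
  have := h.vecMulSL (Matrix.SpecialLinearGroup.map (Int.castRingHom (ZMod M)) γ)
  simpa [Matrix.vecMul, va, dotProduct, Fin.sum_univ_two] using this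

/-- bottom row -/
def brow (M : ℕ) (γ : SL(2, ℤ)) : Fin 2 → ZMod M := fun j => ((γ 1 j : ℤ) : ZMod M)

theorem brow_eq (M : ℕ) (γ : SL(2, ℤ)) : brow M γ = va ![0, 1] γ := by
  funext j; simp [brow, va]

theorem brow_mul (M : ℕ) (γ γ' : SL(2, ℤ)) : brow M (γ * γ') = va (brow M γ) γ' := by
  rw [brow_eq, brow_eq, va_mul]

theorem brow_cop (M : ℕ) (γ : SL(2, ℤ)) : IsCoprime (brow M γ 0) (brow M γ 1) := by
  rw [brow_eq]
  exact va_cop (by simp [isCoprime_one_right]) γ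

theorem brow_surj {M : ℕ} [NeZero M] (v : Fin 2 → ZMod M) (h : IsCoprime (v 0) (v 1)) :
    ∃ γ : SL(2, ℤ), brow M γ = v := by
  have hM : 0 < M := Nat.pos_of_ne_zero (NeZero.ne M)
  obtain ⟨a, b, hab⟩ := h
  set c := (v 0).val + M with hc
  set d := (v 1).val with hd
  have hcv : ((c : ℕ) : ZMod M) = v 0 := by simp [hc]
  have hdv : ((d : ℕ) : ZMod M) = v 1 := by simp [hd]
  set g := Nat.gcd d M with hg
  have hg0 : 0 < g := Nat.gcd_pos_of_pos_right _ hM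
  obtain ⟨d', hd'⟩ : g ∣ d := Nat.gcd_dvd_left _ _
  obtain ⟨M', hM'⟩ : g ∣ M := Nat.gcd_dvd_right _ _
  have hcopdM : Nat.Coprime d' M' := by
    have h1 : g * Nat.gcd d' M' = g * 1 := by
      rw [← Nat.gcd_mul_left, ← hd', ← hM', mul_one]
    exact Nat.eq_of_mul_eq_mul_left hg0 h1
  have hM'0 : M' ≠ 0 := by rintro rfl; simp at hM'; omega
  haveI : NeZero M' := ⟨hM'0⟩
  obtain ⟨p, hpc, hp, hpd⟩ := Nat.forall_exists_prime_gt_and_eq_mod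
    (a := (d' : ZMod M')) ((ZMod.isUnit_iff_coprime d' M').2 hcopdM) c
  have hD : ((g * p : ℕ) : ZMod M) = v 1 := by
    rw [← hdv, ZMod.natCast_eq_natCast_iff, hd', hM']
    exact Nat.ModEq.mul_left' g ((ZMod.natCast_eq_natCast_iff _ _ _).1 hpd)
  have hcg : Nat.Coprime c g := by
    have h1 : (((c.gcd g : ℕ)) : ℤ) ∣ 1 := by
      have h2 : ((a.val * c + b.val * d : ℤ) : ZMod M) = ((1 : ℤ) : ZMod M) := by
        push_cast
        simp [hcv, hdv, hab]
      rw [ZMod.intCast_eq_intCast_iff_dvd_sub] at h2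
      have e1 : ((c.gcd g : ℕ) : ℤ) ∣ c := by exact_mod_cast Nat.gcd_dvd_left c g
      have e2 : ((c.gcd g : ℕ) : ℤ) ∣ d := by
        exact_mod_cast (Nat.gcd_dvd_right c g).trans (Nat.gcd_dvd_left d M)
      have e3 : ((c.gcd g : ℕ) : ℤ) ∣ M := by
        exact_mod_cast (Nat.gcd_dvd_right c g).trans (Nat.gcd_dvd_right d M)
      have e4 := e3.trans h2
      have e5 : ((c.gcd g : ℕ) : ℤ) ∣ (a.val * c + b.val * d : ℤ) :=
        dvd_add (e1.mul_left _) (e2.mul_left _)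
      have := dvd_add e4 e5
      simpa using this
    exact Nat.dvd_one.1 (by exact_mod_cast h1)
  have hcp : Nat.Coprime c p := by
    refine Nat.Coprime.symm ((Nat.Prime.coprime_iff_not_dvd hp).2 fun h => ?_)
    have := Nat.le_of_dvd (by omega) h
    omega
  have hfin : IsCoprime (c : ℤ) ((g * p : ℕ) : ℤ) :=
    Nat.isCoprime_iff_coprime.2 (hcg.mul_right hcp)
  obtain ⟨γ, h0, h1⟩ := hfin.exists_SL2_row 1
  refine ⟨γ, ?_⟩
  funext j
  fin_cases j
  · show ((γ 1 0 : ℤ) : ZMod M) = v 0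
    rw [h0]; simpa using hcv
  · show ((γ 1 1 : ℤ) : ZMod M) = v 1
    rw [h1]; simpa using hD

/-- equivalence given by right multiplication -/
def rowEquiv (γ : SL(2, ℤ)) : (Fin 2 → ℤ) ≃ (Fin 2 → ℤ) where
  toFun i := Matrix.vecMul i γ.1
  invFun i := Matrix.vecMul i (γ⁻¹).1
  left_inv i := by
    simp only [Matrix.vecMul_vecMul, ← Matrix.SpecialLinearGroup.coe_mul]
    simp
  right_inv i := by
    simp only [Matrix.vecMul_vecMul, ← Matrix.SpecialLinearGroup.coe_mul]
    simp

theorem eG_smul {M : ℕ} (v : Fin 2 → ZMod M) (γ : SL(2, ℤ)) (τ : ℍ) :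
    eG M v (γ • τ) = (denom γ τ) ^ (3 : ℤ) * eG M (va v γ) τ := by
  unfold eG
  have hre := (rowEquiv γ).tsum_eq (fun i => (denom γ τ) ^ (3 : ℤ) * eF M (va v γ) τ i)
  have hre2 : (denom γ τ) ^ (3 : ℤ) * (∑' i, eF M (va v γ) τ i) =
      ∑' i, (denom γ τ) ^ (3 : ℤ) * eF M (va v γ) τ i := tsum_mul_left.symm
  rw [mul_left_comm, hre2, ← hre]
  congr 1
  refine tsum_congr fun i => ?_
  unfold eF
  rw [EisensteinSeries.eisSummand_SL2_apply]
  have key : ∀ j, (((rowEquiv γ i) j : ℤ) : ZMod M) = va (fun j => ((i j : ℤ) : ZMod M)) γ j := by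
    intro j
    simp [rowEquiv, Matrix.vecMul, dotProduct, Fin.sum_univ_two, va]
  have iff1 : ((i 0 : ZMod M) = v 0 ∧ (i 1 : ZMod M) = v 1) ↔
    ((((rowEquiv γ i) 0 : ℤ) : ZMod M) = va v γ 0 ∧ (((rowEquiv γ i) 1 : ℤ) : ZMod M) = va v γ 1) := by
    rw [key, key]
    constructor
    · rintro ⟨h0, h1⟩
      simp [va, h0, h1]
    · rintro ⟨h0, h1⟩
      have h2 : (fun j => ((i j : ℤ) : ZMod M)) = v := va_inj γ (by
        funext j; fin_cases j; exacts [h0, h1])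
      exact ⟨congrFun h2 0, congrFun h2 1⟩
  by_cases h : ((i 0 : ZMod M) = v 0 ∧ (i 1 : ZMod M) = v 1)
  · rw [if_pos h, if_pos (iff1.1 h)]; rfl
  · rw [if_neg h, if_neg (fun h' => h (iff1.2 h')), mul_zero]

/-- Galois action on vectors -/
def ls {M : ℕ} (l : ZMod M) (v : Fin 2 → ZMod M) : Fin 2 → ZMod M := ![v 0, l * v 1]

theorem ls_zero {M : ℕ} (l : ZMod M) (v : Fin 2 → ZMod M) : ls l v 0 = v 0 := rfl

theorem ls_one {M : ℕ} (l : ZMod M) (v : Fin 2 → ZMod M) : ls l v 1 = l * v 1 := rfl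

theorem sigma_chi {M : ℕ} [NeZero M] (σ : ℂ →+* ℂ) (l : ZMod M) (h : σ (chi M 1) = chi M l)
    (a : ZMod M) : σ (chi M a) = chi M (l * a) := by
  have h1 : a = (a.val : ZMod M) * 1 := by simp
  have h2 : l * a = (a.val : ZMod M) * l := by simp [mul_comm]
  rw [h2, chi_natmul, ← h]
  conv_lhs => rw [h1, chi_natmul]
  rw [map_pow]

theorem eU_sigma {M : ℕ} [NeZero M] (σ : ℂ →+* ℂ) (l : ZMod M) (h : σ (chi M 1) = chi M l)
    (v : Fin 2 → ZMod M) : PowerSeries.map σ (eU M v) = eU M (ls l v) := by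
  have hk : ∀ b, σ (kap M b) = kap M (l * b) := by
    intro b
    unfold kap
    rw [map_mul, map_sum, map_div₀, map_one, map_mul, map_ofNat, map_natCast]
    congr 1
    refine Finset.sum_congr rfl fun a _ => ?_
    obtain ⟨r, hr⟩ := bern_rat M a.val
    rw [map_mul, hr, sigma_chi σ l h]
    congr 2
    · ring
    · simp
  ext m
  rw [PowerSeries.coeff_map, eU, eU, PowerSeries.coeff_mk, PowerSeries.coeff_mk, ls_zero, ls_one]
  by_cases h1 : m = 0
  · rw [if_pos h1, if_pos h1, map_mul, map_pow, map_natCast]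
    by_cases h2 : v 0 = 0
    · rw [if_pos h2, if_pos h2, hk]
    · rw [if_neg h2, if_neg h2, map_zero]
  · rw [if_neg h1, if_neg h1, map_sum]
    refine Finset.sum_congr rfl fun x _ => ?_
    rw [eA, eA, ls_zero, ls_one, map_mul, map_sub, map_pow, map_natCast]
    have e1 : l * (x.2 * v 1) = x.2 * (l * v 1) := by ring
    have e2 : l * (x.2 * - v 1) = x.2 * - (l * v 1) := by ring
    congr 2
    · by_cases h2 : (x.1 : ZMod M) = v 0
      · rw [if_pos h2, if_pos h2, sigma_chi σ l h, e1]
      · rw [if_neg h2, if_neg h2, map_zero]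
    · by_cases h2 : (x.1 : ZMod M) = - v 0
      · rw [if_pos h2, if_pos h2, sigma_chi σ l h, e2]
      · rw [if_neg h2, if_neg h2, map_zero]

theorem eU_coeff_one {M : ℕ} [NeZero M] (v : Fin 2 → ZMod M) :
    PowerSeries.coeff 1 (eU M v) = eA M v 1 1 := by
  rw [eU, PowerSeries.coeff_mk, if_neg one_ne_zero, Nat.divisorsAntidiagonal_one,
    Finset.sum_singleton]

theorem eU_coeff_two {M : ℕ} [NeZero M] (v : Fin 2 → ZMod M) :
    PowerSeries.coeff 2 (eU M v) = eA M v 1 2 + eA M v 2 1 := by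
  have : Nat.divisorsAntidiagonal 2 = {(1, 2), (2, 1)} := by decide
  rw [eU, PowerSeries.coeff_mk, if_neg two_ne_zero, this, Finset.sum_pair (by decide)]

theorem chi_inj {M : ℕ} [NeZero M] {a b : ZMod M} (h : chi M a = chi M b) : a = b :=
  ZMod.injective_stdAddChar h

theorem chi_zero {M : ℕ} [NeZero M] : chi M (0 : ZMod M) = 1 := by
  unfold chi; exact AddChar.map_zero_eq_one _

theorem eU_base {M : ℕ} [NeZero M] (hM : 4 ≤ M) (w : Fin 2 → ZMod M)
    (h : eU M ![1, 0] = eU M w) : w = ![1, 0] := by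
  have ne : ∀ n : ℕ, 0 < n → n < 4 → (n : ZMod M) ≠ 0 := by
    intro n h0 h4 h
    rw [ZMod.natCast_eq_zero_iff] at h
    have := Nat.le_of_dvd h0 h
    omega
  have n1 : (1 : ZMod M) ≠ 0 := by simpa using ne 1 (by norm_num) (by norm_num)
  have n2 : (2 : ZMod M) ≠ 0 := by simpa using ne 2 (by norm_num) (by norm_num)
  have n3 : (3 : ZMod M) ≠ 0 := by simpa using ne 3 (by norm_num) (by norm_num)
  have a1 : (1 : ZMod M) ≠ -1 := fun h => n2 (by linear_combination h)
  have a2 : (2 : ZMod M) ≠ -1 := fun h => n3 (by linear_combination h)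
  have a3 : (2 : ZMod M) ≠ 1 := fun h => n1 (by linear_combination h)
  have c1 := congrArg (PowerSeries.coeff 1) h
  have c2 := congrArg (PowerSeries.coeff 2) h
  rw [eU_coeff_one, eU_coeff_one] at c1
  rw [eU_coeff_two, eU_coeff_two] at c2
  simp only [eA, Nat.cast_one, Nat.cast_ofNat] at c1 c2
  have z0 : (![1, 0] : Fin 2 → ZMod M) 0 = 1 := rfl
  have z1 : (![1, 0] : Fin 2 → ZMod M) 1 = 0 := rfl
  rw [z0, z1, if_pos rfl, if_neg a1, mul_zero, chi_zero] at c1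
  rw [z0, z1, if_pos rfl, if_neg a1, if_neg a3, if_neg a2, mul_zero, chi_zero] at c2
  by_cases h0 : 1 = w 0
  · rw [if_pos h0, ← h0, if_neg a1] at c1
    have : w 1 = 0 := chi_inj (M := M) (by rw [chi_zero]; rw [one_mul] at c1; linear_combination -c1)
    funext j
    fin_cases j
    · exact h0.symm
    · exact this
  · exfalso
    rw [if_neg h0] at c1 c2
    by_cases h1 : 1 = - w 0
    · have h1' : w 0 = -1 := by rw [h1]; ring
      rw [if_pos h1] at c1 c2
      rw [h1', neg_neg, if_neg a2, if_neg a3] at c2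
      have e2 : chi M (2 * - w 1) = chi M (- w 1) ^ 2 := by
        have := chi_natmul (M := M) 2 (- w 1)
        simpa using this
      rw [e2] at c2
      rw [one_mul] at c1
      have e3 : chi M (- w 1) = -1 := by linear_combination c1
      rw [e3] at c2
      norm_num at c2
    · rw [if_neg h1] at c1
      norm_num at c1

theorem denom_ne (γ : SL(2, ℤ)) (τ : ℍ) : denom γ τ ≠ 0 := denom_ne_zero _ _

theorem eU_inj {M : ℕ} [NeZero M] (hM : 4 ≤ M) {v w : Fin 2 → ZMod M}
    (hv : IsCoprime (v 0) (v 1)) (h : eU M v = eU M w) : v = w := by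
  obtain ⟨γ0, hγ0⟩ := brow_surj v hv
  set γ := γ0⁻¹ * ModularGroup.S with hγ
  have h1 : va v γ = ![1, 0] := by
    rw [← hγ0, brow_eq, va_mul, hγ]
    simp only [mul_inv_cancel_left]
    funext j
    fin_cases j <;> simp [va, ModularGroup.S]
  have h2 : eG M v = eG M w := (eG_HE M v).unique_fun (h ▸ eG_HE M w)
  have h3 : eG M (va v γ) = eG M (va w γ) := by
    funext τ
    have := congrFun h2 (γ • τ)
    rw [eG_smul, eG_smul] at this
    exact mul_left_cancel₀ (zpow_ne_zero _ (denom_ne γ τ)) this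
  have h4 : eU M (va v γ) = eU M (va w γ) := by
    refine HE.unique (by omega) (eG_HE M _) ?_
    rw [h3]; exact eG_HE M _
  rw [h1] at h4
  exact va_inj γ (h1.trans (eU_base hM _ h4).symm)

section lagrange
open Classical

/-- Lagrange numerators -/
def lg {R ι : Type*} [CommRing R] (V : Finset ι) (u : ι → R) (v : ι) : Polynomial R :=
  ∏ w ∈ V.erase v, (Polynomial.X - Polynomial.C (u w))

theorem lg_map {R S ι : Type*} [CommRing R] [CommRing S] (φ : R →+* S) (V : Finset ι) (u : ι → R)
    (v : ι) : (lg V u v).map φ = lg V (fun w => φ (u w)) v := by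
  simp [lg, Polynomial.map_prod]

theorem lg_reindex {R ι : Type*} [CommRing R] (V : Finset ι) (u : ι → R) (e : ι → ι)
    (he : Function.Injective e) (hV : ∀ w, e w ∈ V ↔ w ∈ V) (hs : ∀ w ∈ V, ∃ w', e w' = w) (v : ι) :
    lg V (fun w => u (e w)) v = lg V u (e v) := by
  unfold lg
  refine Finset.prod_bij (fun w _ => e w) ?_ ?_ ?_ ?_
  · intro w hw
    rw [Finset.mem_erase] at hw ⊢
    exact ⟨fun h => hw.1 (he h), (hV w).2 hw.2⟩
  · intro a _ b _ h; exact he h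
  · intro w hw
    rw [Finset.mem_erase] at hw
    obtain ⟨w', rfl⟩ := hs w hw.2
    exact ⟨w', Finset.mem_erase.2 ⟨fun h => hw.1 (h ▸ rfl), (hV w').1 hw.2⟩, rfl⟩
  · intro w _; rfl

theorem lg_deg {R ι : Type*} [CommRing R] [Nontrivial R] (V : Finset ι) (u : ι → R) {v : ι}
    (hv : v ∈ V) : (lg V u v).natDegree < V.card := by
  unfold lg
  rw [Polynomial.natDegree_prod_of_monic _ _ (fun w _ => Polynomial.monic_X_sub_C _)]
  simp only [Polynomial.natDegree_X_sub_C, Finset.sum_const, smul_eq_mul, mul_one]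
  exact Finset.card_erase_lt_of_mem hv

theorem lg_eval {R ι : Type*} [CommRing R] (V : Finset ι) (u : ι → R) (v : ι) (t : R) :
    (lg V u v).eval t = ∏ w ∈ V.erase v, (t - u w) := by
  simp [lg, Polynomial.eval_prod]

theorem lagrange {R ι : Type*} [CommRing R] [Nontrivial R] (V : Finset ι) (u F : ι → R) {v : ι}
    (hv : v ∈ V) : F v * (lg V u v).eval (u v) =
      ∑ j ∈ Finset.range V.card, (lg V u v).coeff j * ∑ w ∈ V, F w * u w ^ j := by
  have h1 : ∀ w ∈ V, w ≠ v → (lg V u v).eval (u w) = 0 := by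
    intro w hw hne
    rw [lg_eval]
    exact Finset.prod_eq_zero (Finset.mem_erase.2 ⟨hne, hw⟩) (sub_self _)
  simp only [Finset.mul_sum]
  rw [Finset.sum_comm]
  have h2 : ∀ w ∈ V, ∑ j ∈ Finset.range V.card, (lg V u v).coeff j * (F w * u w ^ j) =
      F w * (lg V u v).eval (u w) := by
    intro w _
    rw [Polynomial.eval_eq_sum_range' (lg_deg V u hv), Finset.mul_sum]
    exact Finset.sum_congr rfl fun j _ => by ring
  rw [Finset.sum_congr rfl h2, Finset.sum_eq_single_of_mem v hv]
  intro w hw hne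
  rw [h1 w hw hne, mul_zero]

theorem lg_scale {ι : Type*} (V : Finset ι) (u : ι → ℂ) (c : ℂ) (hc : c ≠ 0) {v : ι} (hv : v ∈ V)
    (j : ℕ) : (lg V (fun w => c * u w) v).coeff j =
      c ^ (V.card - 1) * (c⁻¹ ^ j * (lg V u v).coeff j) := by
  have : lg V (fun w => c * u w) v =
      Polynomial.C (c ^ (V.card - 1)) * (lg V u v).comp (Polynomial.C c⁻¹ * Polynomial.X) := by
    unfold lg
    rw [Polynomial.prod_comp, ← Finset.card_erase_of_mem hv, Polynomial.C_pow, ← Finset.prod_const,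
      ← Finset.prod_mul_distrib]
    refine Finset.prod_congr rfl fun w _ => ?_
    simp only [Polynomial.sub_comp, Polynomial.X_comp, Polynomial.C_comp, mul_sub, ← mul_assoc,
      ← Polynomial.C_mul, mul_inv_cancel₀ hc, Polynomial.C_1, one_mul]
  rw [this, Polynomial.coeff_C_mul, Polynomial.comp_C_mul_X_coeff]
  ring

theorem lg_eval_ne {R ι : Type*} [CommRing R] [IsDomain R] (V : Finset ι) (u : ι → R) (v : ι)
    (h : ∀ w ∈ V, u v = u w → w = v) : (lg V u v).eval (u v) ≠ 0 := by
  rw [lg_eval, Finset.prod_ne_zero_iff]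
  intro w hw h'
  rw [Finset.mem_erase] at hw
  exact hw.1 (h w hw.2 (sub_eq_zero.1 h'))

theorem lg_eval_scale {R ι : Type*} [CommRing R] (V : Finset ι) (u : ι → R) (c : R) {v : ι}
    (hv : v ∈ V) : (lg V (fun w => c * u w) v).eval (c * u v) =
      c ^ (V.card - 1) * (lg V u v).eval (u v) := by
  rw [lg_eval, lg_eval, ← Finset.card_erase_of_mem hv, ← Finset.prod_const,
    ← Finset.prod_mul_distrib]
  exact Finset.prod_congr rfl fun w _ => by ring

/-- the vectors -/
def VV (M : ℕ) [NeZero M] : Finset (Fin 2 → ZMod M) :=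
  Finset.univ.filter fun v => IsCoprime (v 0) (v 1)

theorem mem_VV {M : ℕ} [NeZero M] (v : Fin 2 → ZMod M) : v ∈ VV M ↔ IsCoprime (v 0) (v 1) := by
  simp [VV]

theorem va_mem {M : ℕ} [NeZero M] (γ : SL(2, ℤ)) (v : Fin 2 → ZMod M) : va v γ ∈ VV M ↔ v ∈ VV M := by
  rw [mem_VV, mem_VV]
  refine ⟨fun h => ?_, fun h => va_cop h γ⟩
  have := va_cop h γ⁻¹
  rwa [va_mul, mul_inv_cancel, va_one] at this

theorem ls_mem {M : ℕ} [NeZero M] (l : ZMod M) (hl : IsUnit l) (v : Fin 2 → ZMod M) :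
    ls l v ∈ VV M ↔ v ∈ VV M := by
  rw [mem_VV, mem_VV, ls_zero, ls_one]
  exact isCoprime_mul_unit_left_right hl _ _

theorem ls_ls {M : ℕ} (l l' : ZMod M) (v : Fin 2 → ZMod M) : ls l (ls l' v) = ls (l * l') v := by
  funext j; fin_cases j <;> simp [ls, mul_assoc]

theorem ls_id {M : ℕ} (v : Fin 2 → ZMod M) : ls 1 v = v := by
  funext j; fin_cases j <;> simp [ls]

theorem lg_va {R : Type*} [CommRing R] {M : ℕ} [NeZero M] (γ : SL(2, ℤ)) (u : (Fin 2 → ZMod M) → R)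
    (v : Fin 2 → ZMod M) : lg (VV M) (fun w => u (va w γ)) v = lg (VV M) u (va v γ) :=
  lg_reindex _ _ (fun w => va w γ) (fun _ _ h => va_inj γ h) (fun w => va_mem γ w)
    (fun w _ => ⟨va w γ⁻¹, by simp [va_mul, va_one]⟩) v

theorem lg_ls {R : Type*} [CommRing R] {M : ℕ} [NeZero M] (l : ZMod M) (hl : IsUnit l)
    (u : (Fin 2 → ZMod M) → R) (v : Fin 2 → ZMod M) :
    lg (VV M) (fun w => u (ls l w)) v = lg (VV M) u (ls l v) := by
  obtain ⟨l', hl'⟩ := hl.exists_right_inv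
  refine lg_reindex _ _ (fun w => ls l w) ?_ (fun w => ls_mem l hl w) ?_ v
  · intro a b h
    have := congrArg (ls l') h
    simpa [ls_ls, mul_comm l' l, hl', ls_id] using this
  · intro w _
    exact ⟨ls l' w, by simp [ls_ls, hl', ls_id]⟩

/-- coefficient functions -/
def bf {M : ℕ} [NeZero M] (v : Fin 2 → ZMod M) (j : ℕ) (τ : ℍ) : ℂ :=
  (lg (VV M) (fun w => eG M w τ) v).coeff j

/-- coefficient series -/
def bH {M : ℕ} [NeZero M] (v : Fin 2 → ZMod M) (j : ℕ) : PowerSeries ℂ :=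
  (lg (VV M) (fun w => eU M w) v).coeff j

/-- discriminant factor -/
def hf {M : ℕ} [NeZero M] (v : Fin 2 → ZMod M) (τ : ℍ) : ℂ :=
  (lg (VV M) (fun w => eG M w τ) v).eval (eG M v τ)

/-- discriminant series -/
def hH {M : ℕ} [NeZero M] (v : Fin 2 → ZMod M) : PowerSeries ℂ :=
  (lg (VV M) (fun w => eU M w) v).eval (eU M v)

/-- pair -/
def ePair (M : ℕ) [NeZero M] (v : Fin 2 → ZMod M) : expRing M := ⟨(eG M v, eU M v), eG_HE M v⟩

/-- evaluation -/
def evR (M : ℕ) (τ : ℍ) : expRing M →+* ℂ :=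
  (Pi.evalRingHom (fun _ : ℍ => ℂ) τ).comp ((RingHom.fst _ _).comp (expRing M).subtype)

/-- series -/
def seR (M : ℕ) : expRing M →+* PowerSeries ℂ :=
  (RingHom.snd _ _).comp (expRing M).subtype

theorem expR_HE (M : ℕ) (r : expRing M) : HE M (fun τ => evR M τ r) (seR M r) := r.2

theorem bf_HE {M : ℕ} [NeZero M] (v : Fin 2 → ZMod M) (j : ℕ) : HE M (bf v j) (bH v j) := by
  have := expR_HE M ((lg (VV M) (ePair M) v).coeff j)
  have e1 : bH v j = seR M ((lg (VV M) (ePair M) v).coeff j) := by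
    rw [← Polynomial.coeff_map, lg_map]; rfl
  have e2 : bf v j = fun τ => evR M τ ((lg (VV M) (ePair M) v).coeff j) := by
    funext τ
    rw [← Polynomial.coeff_map, lg_map]; rfl
  rw [e1, e2]; exact this

theorem hf_HE {M : ℕ} [NeZero M] (v : Fin 2 → ZMod M) : HE M (hf v) (hH v) := by
  have := expR_HE M ((lg (VV M) (ePair M) v).eval (ePair M v))
  have e1 : hH v = seR M ((lg (VV M) (ePair M) v).eval (ePair M v)) := by
    rw [← Polynomial.eval_map_apply, lg_map]; rfl
  have e2 : hf v = fun τ => evR M τ ((lg (VV M) (ePair M) v).eval (ePair M v)) := by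
    funext τ
    rw [← Polynomial.eval_map_apply, lg_map]; rfl
  rw [e1, e2]; exact this

theorem bH_sigma {M : ℕ} [NeZero M] (σ : ℂ →+* ℂ) (l : ZMod M) (hl : IsUnit l)
    (h : σ (chi M 1) = chi M l) (v : Fin 2 → ZMod M) (j : ℕ) :
    PowerSeries.map σ (bH v j) = bH (ls l v) j := by
  unfold bH
  rw [← Polynomial.coeff_map, lg_map, ← lg_ls l hl]
  simp only [eU_sigma σ l h]

theorem hH_sigma {M : ℕ} [NeZero M] (σ : ℂ →+* ℂ) (l : ZMod M) (hl : IsUnit l)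
    (h : σ (chi M 1) = chi M l) (v : Fin 2 → ZMod M) :
    PowerSeries.map σ (hH v) = hH (ls l v) := by
  unfold hH
  rw [← Polynomial.eval_map_apply, lg_map, ← lg_ls l hl]
  simp only [eU_sigma σ l h]

theorem hH_ne {M : ℕ} [NeZero M] (hM : 4 ≤ M) (v : Fin 2 → ZMod M) (hv : v ∈ VV M) : hH v ≠ 0 := by
  exact lg_eval_ne _ _ _ fun w _ h => (eU_inj hM ((mem_VV v).1 hv) h).symm

theorem bf_smul {M : ℕ} [NeZero M] (v : Fin 2 → ZMod M) (hv : v ∈ VV M) (j : ℕ) (γ : SL(2, ℤ)) (τ : ℍ) :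
    bf v j (γ • τ) = (denom γ τ ^ (3 : ℤ)) ^ ((VV M).card - 1) *
      (((denom γ τ ^ (3 : ℤ))⁻¹) ^ j * bf (va v γ) j τ) := by
  unfold bf
  simp only [eG_smul]
  rw [lg_scale (VV M) (fun w => eG M (va w γ) τ) _ (zpow_ne_zero _ (denom_ne γ τ)) hv,
    lg_va γ (fun w => eG M w τ)]

theorem hf_smul {M : ℕ} [NeZero M] (v : Fin 2 → ZMod M) (hv : v ∈ VV M) (γ : SL(2, ℤ)) (τ : ℍ) :
    hf v (γ • τ) = (denom γ τ ^ (3 : ℤ)) ^ ((VV M).card - 1) * hf (va v γ) τ := by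
  unfold hf
  rw [← lg_va γ (fun w => eG M w τ)]
  simp only [eG_smul]
  exact lg_eval_scale (VV M) (fun w => eG M (va w γ) τ) _ hv

end lagrange

theorem HE_of_periodic {M : ℕ} (hM : 0 < M) (f : ℍ → ℂ)
    (hper : ∀ τ : ℍ, f (((M : ℤ) : ℝ) +ᵥ τ) = f τ)
    (hol : MDifferentiable (modelWithCornersSelf ℂ ℂ) (modelWithCornersSelf ℂ ℂ) f)
    (hb : IsBoundedAtImInfty f) : HE M f (qExpansion M f) := by
  rw [HE_iff]
  intro τ
  have hp : Function.Periodic (f ∘ ofComplex) (M : ℝ) := by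
    intro w
    by_cases hw : 0 < im w
    · have : 0 < im (w + (M : ℝ)) := by simp [hw]
      simp only [Function.comp_apply, ofComplex_apply_of_im_pos this, ofComplex_apply_of_im_pos hw]
      convert! hper ⟨w, hw⟩ using 2
      ext
      simp [add_comm]
    · rw [not_lt] at hw
      have : im (w + (M : ℝ)) ≤ 0 := by simpa using hw
      rw [Function.comp_apply, Function.comp_apply, ofComplex_apply_of_im_nonpos this,
        ofComplex_apply_of_im_nonpos hw]
  have := UpperHalfPlane.hasSum_qExpansion (h := (M : ℝ)) (by exact_mod_cast hM) hp hol hb τ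
  simpa using this

theorem denom_coe (γ : SL(2, ℤ)) (τ : ℍ) :
    denom γ τ = (γ 1 0 : ℂ) * τ + (γ 1 1 : ℂ) := by
  simp [denom]

theorem fs_brow {N : ℕ} {k : ℤ} (f : ModularForm (Gamma1 N) k) {γ γ' : SL(2, ℤ)}
    (h : brow N γ = brow N γ') : (⇑f) ∣[k] γ = (⇑f) ∣[k] γ' := by
  set δ := γ * γ'⁻¹ with hδ
  have h1 : brow N δ = ![0, 1] := by
    rw [hδ, brow_mul, h, ← brow_mul, mul_inv_cancel, brow_eq, va_one]
  have h10 : ((δ 1 0 : ℤ) : ZMod N) = 0 := congrFun h1 0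
  have h11 : ((δ 1 1 : ℤ) : ZMod N) = 1 := congrFun h1 1
  have hdet : ((δ 0 0 : ℤ) : ZMod N) = 1 := by
    have := δ.2
    rw [Matrix.det_fin_two] at this
    have := congrArg (Int.cast : ℤ → ZMod N) this
    push_cast at this
    rw [h10, h11] at this
    simpa using this
  have hm : δ ∈ Gamma1 N := (Gamma1_mem N δ).2 ⟨hdet, h11, h10⟩
  have h2 : (⇑f) ∣[k] δ = ⇑f := SlashInvariantFormClass.slash_action_eq f _
    (Subgroup.mem_map_of_mem _ hm)
  have h3 : γ = δ * γ' := by simp [hδ]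
  rw [h3, SlashAction.slash_mul, h2]

theorem fs_bdd {N : ℕ} [NeZero N] {k : ℤ} (f : ModularForm (Gamma1 N) k) (γ : SL(2, ℤ)) :
    IsBoundedAtImInfty ((⇑f) ∣[k] γ) := by
  have hc : IsCusp (Matrix.SpecialLinearGroup.mapGL ℝ γ • OnePoint.infty) 𝒮ℒ :=
    isCusp_SL2Z_iff'.2 ⟨γ, rfl⟩
  have hc' := (Subgroup.IsArithmetic.isCusp_iff_isCusp_SL2Z
    ((Gamma1 N : Subgroup SL(2, ℤ)) : Subgroup (GL (Fin 2) ℝ))).2 hc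
  exact (OnePoint.isBoundedAt_iff_forall_SL2Z hc).1 (ModularFormClass.bdd_at_cusps f hc') γ rfl

theorem fs_hol {N : ℕ} {k : ℤ} (f : ModularForm (Gamma1 N) k) (γ : SL(2, ℤ)) :
    MDifferentiable (modelWithCornersSelf ℂ ℂ) (modelWithCornersSelf ℂ ℂ) ((⇑f) ∣[k] γ) :=
  (ModularFormClass.holo f).slash k _

theorem fs_smul {k : ℤ} (f : ℍ → ℂ) (γ γ' : SL(2, ℤ)) (τ : ℍ) :
    (f ∣[k] γ) (γ' • τ) = denom γ' τ ^ k * (f ∣[k] (γ * γ')) τ := by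
  rw [SlashAction.slash_mul, ModularForm.SL_slash_apply _ γ', zpow_neg, mul_comm, mul_assoc,
    inv_mul_cancel₀ (zpow_ne_zero _ (denom_ne γ' τ)), mul_one]

theorem fs_HE {N M : ℕ} [NeZero N] (hM : 0 < M) (hNM : N ∣ M) {k : ℤ} (f : ModularForm (Gamma1 N) k)
    (γ : SL(2, ℤ)) : HE M ((⇑f) ∣[k] γ) (qExpansion M ((⇑f) ∣[k] γ)) := by
  refine HE_of_periodic hM _ (fun τ => ?_) (fs_hol f γ) (fs_bdd f γ)
  rw [← modular_T_zpow_smul, fs_smul]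
  have hd : denom ((ModularGroup.T ^ (M : ℤ) : SL(2, ℤ))) τ = 1 := by
    rw [denom_coe, ModularGroup.coe_T_zpow]; simp
  rw [hd, one_zpow, one_mul]
  refine congrFun (fs_brow f ?_) τ
  rw [brow_mul]
  funext j
  have : ((M : ℕ) : ZMod N) = 0 := (ZMod.natCast_eq_zero_iff _ _).2 hNM
  unfold va
  rw [ModularGroup.coe_T_zpow]
  fin_cases j <;> simp [this]

theorem mk_level_one {M : ℕ} (hM : 0 < M) {w : ℤ} (g : ℍ → ℂ) (p : PowerSeries ℂ) (hp : HE M g p)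
    (hg : ∀ (γ : SL(2, ℤ)) (τ : ℍ), g (γ • τ) = denom γ τ ^ w * g τ) :
    ∃ G : ModularForm 𝒮ℒ w, ⇑G = g := by
  have hinv : ∀ γ : SL(2, ℤ), g ∣[w] γ = g := by
    intro γ
    funext τ
    rw [ModularForm.SL_slash_apply, hg, zpow_neg, mul_comm, ← mul_assoc,
      inv_mul_cancel₀ (zpow_ne_zero _ (denom_ne γ τ)), one_mul]
  refine ⟨{ toFun := g, slash_action_eq' := ?_, holo' := hp.mdiff hM, bdd_at_cusps' := ?_ }, rfl⟩
  · rintro γ ⟨γ, rfl⟩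
    exact hinv γ
  · intro c hc
    rw [OnePoint.isBoundedAt_iff_forall_SL2Z hc]
    intro γ _
    rw [hinv γ]
    exact hp.bdd hM

theorem gal_level {M : ℕ} (hM : 0 < M) (σ : ℂ →+* ℂ) {w : ℤ} (g : ℍ → ℂ) (p : PowerSeries ℂ)
    (hp : HE M g p) (hg : ∀ (γ : SL(2, ℤ)) (τ : ℍ), g (γ • τ) = denom γ τ ^ w * g τ) :
    ∃ g' : ℍ → ℂ, HE M g' (PowerSeries.map σ p) ∧
      ∀ (γ : SL(2, ℤ)) (τ : ℍ), g' (γ • τ) = denom γ τ ^ w * g' τ := by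
  obtain ⟨G, rfl⟩ := mk_level_one hM g p hp hg
  obtain ⟨G', hG'⟩ := gal1 σ G (HE_levelOne G)
  refine ⟨G', ?_, ?_⟩
  · have h1 := (HE_levelOne G).expand hM one_pos
    rw [one_mul] at h1
    rw [hp.unique hM h1, expandPS_map]
    have h2 := hG'.expand hM one_pos
    rwa [one_mul] at h2
  · intro γ τ
    have h1 : (⇑G') ∣[w] γ = ⇑G' := SlashInvariantFormClass.slash_action_eq G' _ ⟨γ, rfl⟩
    have := fs_smul (k := w) (⇑G') 1 γ τ
    rwa [SlashAction.slash_one, one_mul, h1] at this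

theorem HE.sum {M : ℕ} {ι : Type*} (s : Finset ι) (f : ι → ℍ → ℂ) (p : ι → PowerSeries ℂ)
    (h : ∀ i ∈ s, HE M (f i) (p i)) : HE M (fun τ => ∑ i ∈ s, f i τ) (∑ i ∈ s, p i) := by
  have h1 : (∑ i ∈ s, ((f i, p i) : (ℍ → ℂ) × PowerSeries ℂ)) ∈ expRing M :=
    Subring.sum_mem _ fun i hi => h i hi
  have h2 : (fun τ => ∑ i ∈ s, f i τ) = (∑ i ∈ s, ((f i, p i) : (ℍ → ℂ) × PowerSeries ℂ)).1 := by
    rw [Prod.fst_sum]; funext τ; simp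
  have h3 : (∑ i ∈ s, p i) = (∑ i ∈ s, ((f i, p i) : (ℍ → ℂ) × PowerSeries ℂ)).2 := by
    rw [Prod.snd_sum]
  rw [h2, h3]; exact h1

open Classical in
/-- translates -/
def fv {N : ℕ} {k : ℤ} (f : ModularForm (Gamma1 N) k) {M : ℕ} [NeZero M] (v : Fin 2 → ZMod M) : ℍ → ℂ :=
  if h : IsCoprime (v 0) (v 1) then (⇑f) ∣[k] (brow_surj v h).choose else 0

theorem brow_dvd {N M : ℕ} (hNM : N ∣ M) {γ γ' : SL(2, ℤ)} (h : brow M γ = brow M γ') :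
    brow N γ = brow N γ' := by
  funext j
  have := congrArg (ZMod.castHom hNM (ZMod N)) (congrFun h j)
  simpa [brow] using this

theorem fv_eq {N : ℕ} {k : ℤ} (f : ModularForm (Gamma1 N) k) {M : ℕ} [NeZero M] (hNM : N ∣ M)
    (γ : SL(2, ℤ)) : fv f (brow M γ) = (⇑f) ∣[k] γ := by
  have h := brow_cop M γ
  rw [fv, dif_pos h]
  exact fs_brow f (brow_dvd hNM (brow_surj _ h).choose_spec)

theorem fv_smul {N : ℕ} {k : ℤ} (f : ModularForm (Gamma1 N) k) {M : ℕ} [NeZero M] (hNM : N ∣ M)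
    (v : Fin 2 → ZMod M) (hv : v ∈ VV M) (γ : SL(2, ℤ)) (τ : ℍ) :
    fv f v (γ • τ) = denom γ τ ^ k * fv f (va v γ) τ := by
  obtain ⟨γ0, rfl⟩ := brow_surj v ((mem_VV v).1 hv)
  rw [fv_eq f hNM, ← brow_mul, fv_eq f hNM, fs_smul]

/-- their expansions -/
def ph {N : ℕ} {k : ℤ} (f : ModularForm (Gamma1 N) k) {M : ℕ} [NeZero M] (v : Fin 2 → ZMod M) :
    PowerSeries ℂ := qExpansion M (fv f v)

theorem fv_HE {N : ℕ} [NeZero N] {k : ℤ} (f : ModularForm (Gamma1 N) k) {M : ℕ} [NeZero M] (hNM : N ∣ M)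
    (v : Fin 2 → ZMod M) (hv : v ∈ VV M) : HE M (fv f v) (ph f v) := by
  obtain ⟨γ0, rfl⟩ := brow_surj v ((mem_VV v).1 hv)
  unfold ph
  rw [fv_eq f hNM]
  exact fs_HE (Nat.pos_of_ne_zero (NeZero.ne M)) hNM f γ0

theorem trace_smul {N : ℕ} {k : ℤ} (f : ModularForm (Gamma1 N) k) {M : ℕ} [NeZero M] (hNM : N ∣ M)
    (j : ℕ) (γ : SL(2, ℤ)) (τ : ℍ) :
    ∑ v ∈ VV M, fv f v (γ • τ) * eG M v (γ • τ) ^ j =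
      denom γ τ ^ (k + 3 * j) * ∑ v ∈ VV M, fv f v τ * eG M v τ ^ j := by
  rw [Finset.mul_sum]
  refine Finset.sum_bij (fun v _ => va v γ) (fun v hv => (va_mem γ v).2 hv)
    (fun a _ b _ h => va_inj γ h) (fun w hw => ⟨va w γ⁻¹, (va_mem _ _).2 hw, by simp [va_mul, va_one]⟩) ?_
  intro v hv
  rw [fv_smul f hNM v hv, eG_smul, zpow_add₀ (denom_ne γ τ), zpow_mul, zpow_natCast]
  ring

theorem exists_pt {N : ℕ} [NeZero N] {k : ℤ} (f : ModularForm (Gamma1 N) k) {M : ℕ} [NeZero M]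
    (hNM : N ∣ M) (σ : ℂ →+* ℂ) (j : ℕ) :
    ∃ g' : ℍ → ℂ, HE M g' (PowerSeries.map σ (∑ v ∈ VV M, ph f v * eU M v ^ j)) ∧
      ∀ (γ : SL(2, ℤ)) (τ : ℍ), g' (γ • τ) = denom γ τ ^ (k + 3 * j) * g' τ := by
  have hM : 0 < M := Nat.pos_of_ne_zero (NeZero.ne M)
  refine gal_level hM σ (fun τ => ∑ v ∈ VV M, fv f v τ * eG M v τ ^ j) _ ?_
    (fun γ τ => trace_smul f hNM j γ τ)
  refine HE.sum (VV M) (fun v τ => fv f v τ * eG M v τ ^ j) _ fun v hv => ?_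
  exact (fv_HE f hNM v hv).mul ((eG_HE M v).pow j)

theorem main_R {N : ℕ} [NeZero N] {k : ℤ} (f : ModularForm (Gamma1 N) k) {M : ℕ} [NeZero M]
    (hNM : N ∣ M) (σ : ℂ →+* ℂ) (l : ZMod M) (hl : IsUnit l) (h : σ (chi M 1) = chi M l) :
    ∃ R : (Fin 2 → ZMod M) → ℍ → ℂ,
      (∀ v ∈ VV M, ∀ (γ : SL(2, ℤ)) (τ : ℍ), R v (γ • τ) =
        denom γ τ ^ k * ((denom γ τ ^ (3 : ℤ)) ^ ((VV M).card - 1) * R (va v γ) τ)) ∧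
      ∀ v ∈ VV M, HE M (R (ls l v)) (PowerSeries.map σ (ph f v) * hH (ls l v)) := by
  choose pt hpt1 hpt2 using exists_pt f hNM σ
  refine ⟨fun v τ => ∑ j ∈ Finset.range (VV M).card, bf v j τ * pt j τ, ?_, ?_⟩
  · intro v hv γ τ
    simp only [Finset.mul_sum]
    refine Finset.sum_congr rfl fun j _ => ?_
    rw [bf_smul v hv, hpt2, zpow_add₀ (denom_ne γ τ), zpow_mul, zpow_natCast]
    have : denom γ τ ^ (3 : ℤ) ≠ 0 := zpow_ne_zero _ (denom_ne γ τ)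
    rw [inv_pow]
    have h2 : ((denom γ τ ^ (3 : ℤ)) ^ j)⁻¹ * (denom γ τ ^ (3 : ℤ)) ^ j = 1 :=
      inv_mul_cancel₀ (pow_ne_zero _ this)
    linear_combination (denom γ τ ^ k * ((denom γ τ ^ (3 : ℤ)) ^ ((VV M).card - 1) *
      (bf (va v γ) j τ * pt j τ))) * h2
  · intro v hv
    have h1 := lagrange (VV M) (fun w => eU M w) (fun w => ph f w) hv
    have h2 := congrArg (PowerSeries.map σ) h1
    rw [map_mul, map_sum] at h2
    have h3 : PowerSeries.map σ ((lg (VV M) (fun w => eU M w) v).eval (eU M v)) = hH (ls l v) :=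
      hH_sigma σ l hl h v
    rw [← h3, h2]
    refine HE.sum _ (fun j τ => bf (ls l v) j τ * pt j τ) _ fun j _ => ?_
    rw [map_mul]
    have h4 : PowerSeries.map σ ((lg (VV M) (fun w => eU M w) v).coeff j) = bH (ls l v) j :=
      bH_sigma σ l hl h v j
    rw [h4]
    exact (bf_HE _ _).mul (hpt1 j)

theorem f_slash_one {k : ℤ} (f : ℍ → ℂ) (γ : SL(2, ℤ)) (τ : ℍ) :
    f (γ • τ) = denom γ τ ^ k * (f ∣[k] γ) τ := by
  have := fs_smul (k := k) f 1 γ τ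
  rwa [SlashAction.slash_one, one_mul] at this

/-- lower triangular unipotent -/
def lowU (m : ℤ) : SL(2, ℤ) := ⟨!![1, 0; m, 1], by simp [Matrix.det_fin_two]⟩

theorem gal_main {N : ℕ} [NeZero N] {k : ℤ} (hk : 1 ≤ k) (f : ModularForm (Gamma1 N) k) {M : ℕ} [NeZero M]
    (hM4 : 4 ≤ M) (hNM : N ∣ M) (σ : ℂ →+* ℂ) (l : ZMod M) (hl : IsUnit l) (h : σ (chi M 1) = chi M l)
    (φ : PowerSeries ℂ) (hφ : HE M f φ) (c : ℂ)
    (hφc : HE M (fun τ => f τ + c) (PowerSeries.map σ φ))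
    (γ0 γ : SL(2, ℤ)) (hγ : va ![0, l] γ = ls l (brow M γ0)) (hγN : brow N γ = brow N γ0)
    (ψ : PowerSeries ℂ) (hψ : HE M ((⇑f) ∣[k] γ0) ψ) : PowerSeries.map σ ψ = ψ := by
  have hM : 0 < M := by omega
  obtain ⟨R, hR1, hR2⟩ := main_R f hNM σ l hl h
  have he : (![0, 1] : Fin 2 → ZMod M) ∈ VV M := by
    rw [mem_VV]; simp [isCoprime_one_right]
  have hlse : ls l (![0, 1] : Fin 2 → ZMod M) = ![0, l] := by
    funext j; fin_cases j <;> simp [ls]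
  have he' : (![0, l] : Fin 2 → ZMod M) ∈ VV M := by
    rw [← hlse]; exact (ls_mem l hl _).2 he
  have hfe : fv f (![0, 1] : Fin 2 → ZMod M) = f := by
    have := fv_eq f hNM (1 : SL(2, ℤ))
    rwa [brow_eq, va_one, SlashAction.slash_one] at this
  have hpe : ph f (![0, 1] : Fin 2 → ZMod M) = φ := by
    have := fv_HE f hNM _ he
    rw [hfe] at this
    exact this.unique hM hφ
  have key1 : ∀ τ, (f τ + c) * hf ![0, l] τ = R ![0, l] τ := by
    have h1 := hR2 _ he
    rw [hpe, hlse] at h1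
    have h2 := hφc.mul (hf_HE ![0, l])
    have h3 := h2.unique_fun h1
    intro τ
    exact congrFun h3 τ
  have hc : c = 0 := by
    by_contra hc0
    have hz : hf (![0, l] : Fin 2 → ZMod M) = 0 := by
      funext τ
      obtain ⟨m, hm⟩ := exists_nat_gt (1 / τ.im)
      set g := lowU ((m : ℤ) * M) with hg
      have hva : va (![0, l] : Fin 2 → ZMod M) g = ![0, l] := by
        funext j; fin_cases j <;> simp [va, hg, lowU]
      have hbr : brow N g = brow N 1 := by
        have : ((M : ℕ) : ZMod N) = 0 := (ZMod.natCast_eq_zero_iff _ _).2 hNM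
        funext j; fin_cases j <;> simp [brow, hg, lowU, this]
      have hfg : (⇑f) ∣[k] g = ⇑f := by rw [fs_brow f hbr, SlashAction.slash_one]
      have e1 := key1 (g • τ)
      have e2 := key1 τ
      rw [hf_smul _ he', hR1 _ he', hva, f_slash_one (k := k) (⇑f), hfg, ← e2] at e1
      set J := denom g τ with hJ
      have hJ0 : J ≠ 0 := denom_ne g τ
      have hJn : 1 < ‖J‖ := by
        have h1 : J = ((m : ℂ) * M) * τ + 1 := by
          rw [hJ, denom_coe]; simp [hg, lowU]
        have h2 : J.im = m * M * τ.im := by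
          rw [h1]; simp
        have h3 : 1 < J.im := by
          rw [h2]
          have h4 : 1 < m * τ.im := by rwa [div_lt_iff₀ τ.im_pos] at hm
          have h5 : (1 : ℝ) ≤ M := by exact_mod_cast hM
          nlinarith
        exact h3.trans_le ((le_abs_self _).trans (Complex.abs_im_le_norm J))
      have hJk : J ^ k ≠ 1 := by
        intro hJ1
        have h1 := one_lt_zpow₀ hJn (show 0 < k by omega)
        rw [← norm_zpow, hJ1, norm_one] at h1
        exact lt_irrefl _ h1
      have hA : (J ^ (3 : ℤ)) ^ ((VV M).card - 1) ≠ 0 := pow_ne_zero _ (zpow_ne_zero _ hJ0)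
      have e3 : (J ^ (3 : ℤ)) ^ ((VV M).card - 1) * (c * ((1 - J ^ k) * hf ![0, l] τ)) = 0 := by
        linear_combination e1
      have e4 := (mul_eq_zero.1 ((mul_eq_zero.1 ((mul_eq_zero.1 e3).resolve_left hA)).resolve_left
        hc0)).resolve_left (sub_ne_zero.2 (Ne.symm hJk))
      exact e4
    have := hf_HE (M := M) ![0, l]
    rw [hz] at this
    exact hH_ne hM4 _ he' (this.eq_zero hM)
  have hv0 : brow M γ0 ∈ VV M := (mem_VV _).2 (brow_cop M γ0)
  have key2 : ∀ τ, ((⇑f) ∣[k] γ0) τ * hf (ls l (brow M γ0)) τ = R (ls l (brow M γ0)) τ := by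
    intro τ
    have e1 := key1 (γ • τ)
    rw [hc, add_zero, hf_smul _ he', hR1 _ he', hγ, f_slash_one (k := k) (⇑f), fs_brow f hγN] at e1
    have hJ0 : denom γ τ ≠ 0 := denom_ne γ τ
    have hA : denom γ τ ^ k * (denom γ τ ^ (3 : ℤ)) ^ ((VV M).card - 1) ≠ 0 :=
      mul_ne_zero (zpow_ne_zero _ hJ0) (pow_ne_zero _ (zpow_ne_zero _ hJ0))
    apply mul_left_cancel₀ hA
    linear_combination e1
  have hp0 : ph f (brow M γ0) = ψ := by
    have := fv_HE f hNM _ hv0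
    rw [fv_eq f hNM] at this
    exact this.unique hM hψ
  have h1 := hR2 _ hv0
  rw [hp0] at h1
  have h2 := hψ.mul (hf_HE (ls l (brow M γ0)))
  have h3 : ((⇑f) ∣[k] γ0) * hf (ls l (brow M γ0)) = R (ls l (brow M γ0)) := funext key2
  rw [h3] at h2
  exact mul_right_cancel₀ (hH_ne hM4 _ ((ls_mem l hl _).2 hv0)) (h1.unique hM h2)

theorem chi_prim (M : ℕ) [NeZero M] : IsPrimitiveRoot (chi M 1) M := by
  have := chi_coe (M := M) 1
  rw [Int.cast_one] at this
  rw [this]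
  have h2 := Complex.isPrimitiveRoot_exp M (NeZero.ne M)
  convert! h2 using 2
  simp

theorem sigma_unit {M : ℕ} [NeZero M] (σ : ℂ →+* ℂ) :
    ∃ l : ZMod M, IsUnit l ∧ σ (chi M 1) = chi M l := by
  have h1 := chi_prim M
  have h2 : IsPrimitiveRoot (σ (chi M 1)) M := h1.map_of_injective σ.injective
  obtain ⟨i, _, hi⟩ := h1.eq_pow_of_pow_eq_one h2.pow_eq_one
  refine ⟨(i : ZMod M), ?_, ?_⟩
  · rw [ZMod.isUnit_iff_coprime]
    rw [← hi] at h2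
    exact (h1.pow_iff_coprime (Nat.pos_of_ne_zero (NeZero.ne M)) i).1 h2
  · rw [← hi, ← chi_natmul, mul_one]

/-- scaling -/
def qm (Q : ℕ) (hQ : 0 < Q) (τ : ℍ) : ℍ :=
  ⟨(Q : ℂ) * τ, by
    simpa using mul_pos (show (0 : ℝ) < Q by exact_mod_cast hQ) τ.im_pos⟩

theorem qm_coe (Q : ℕ) (hQ : 0 < Q) (τ : ℍ) : ((qm Q hQ τ : ℍ) : ℂ) = (Q : ℂ) * τ := rfl

/-- division -/
def qd (Q : ℕ) (hQ : 0 < Q) (τ : ℍ) : ℍ :=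
  ⟨(τ : ℂ) / Q, by
    have : (0 : ℝ) < Q := by exact_mod_cast hQ
    simpa using div_pos τ.im_pos this⟩

theorem qd_coe (Q : ℕ) (hQ : 0 < Q) (τ : ℍ) : ((qd Q hQ τ : ℍ) : ℂ) = (τ : ℂ) / Q := rfl

theorem qm_qd (Q : ℕ) (hQ : 0 < Q) (τ : ℍ) : qm Q hQ (qd Q hQ τ) = τ := by
  have : (Q : ℂ) ≠ 0 := by exact_mod_cast hQ.ne'
  ext
  rw [qm_coe, qd_coe]
  field_simp

/-- the matrix -/
def g0 (Q N' : ℕ) (x y z w : ℤ) (h : (Q : ℤ) * x * w - N' * y * z = 1) : SL(2, ℤ) :=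
  ⟨!![x, y; N' * z, Q * w], by rw [Matrix.det_fin_two_of]; linear_combination h⟩

theorem smul_coe (γ : SL(2, ℤ)) (τ : ℍ) : ((γ • τ : ℍ) : ℂ) =
    ((γ 0 0 : ℂ) * τ + (γ 0 1 : ℂ)) / ((γ 1 0 : ℂ) * τ + (γ 1 1 : ℂ)) := by
  rw [UpperHalfPlane.specialLinearGroup_apply]
  simp

theorem W_eq (Q N' : ℕ) (hQ : 0 < Q) (x y z w : ℤ) (h : (Q : ℤ) * x * w - N' * y * z = 1) (k : ℤ)
    (f WQf : ℍ → ℂ)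
    (hW : ∀ τ τ' : ℍ, (τ' : ℂ) = ((Q : ℂ) * x * τ + y) / (((Q * N' : ℕ) : ℂ) * z * τ + Q * w) →
      WQf τ = ((Real.sqrt Q : ℝ) : ℂ) ^ k * (((Q * N' : ℕ) : ℂ) * z * τ + Q * w) ^ (-k) * f τ') (τ : ℍ) :
    WQf τ = ((Real.sqrt Q : ℝ) : ℂ) ^ k * (f ∣[k] (g0 Q N' x y z w h)) (qm Q hQ τ) := by
  have hd : denom (g0 Q N' x y z w h) (qm Q hQ τ) = (((Q * N' : ℕ) : ℂ) * z * τ + Q * w) := by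
    rw [denom_coe, qm_coe]
    simp [g0]; ring
  rw [hW τ (g0 Q N' x y z w h • qm Q hQ τ), ModularForm.SL_slash_apply, hd]
  · ring
  · rw [smul_coe, ← denom_coe, hd, qm_coe]
    simp [g0]; ring

theorem part_two (N Q N' : ℕ) (hN : N = Q * N') (hQ : 0 < Q) (hN' : 0 < N') (x y z w : ℤ)
    (h : (Q : ℤ) * x * w - N' * y * z = 1) (k : ℤ) (hk : 1 ≤ k)
    (f : ModularForm (Gamma1 N) k) (a : ℕ → ℂ) (ha : HasExpansion 1 (⇑f) a) (WQf : ℍ → ℂ)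
    (hW : ∀ τ : ℍ, WQf τ =
      ((Real.sqrt Q : ℝ) : ℂ) ^ k * ((⇑f) ∣[k] (g0 Q N' x y z w h)) (qm Q hQ τ))
    (c : ℕ → ℂ) (hc : HasExpansion 1 WQf c) (n : ℕ) :
    ∃ t ∈ Subfield.closure ({v : ℂ | ∃ j : ℕ, 1 ≤ j ∧ v = a j} ∪ {zetaC Q}),
      c n = ((Real.sqrt Q : ℝ) : ℂ) ^ k * t := by
  set s : ℂ := ((Real.sqrt Q : ℝ) : ℂ) ^ k with hs
  have hQC : (Q : ℂ) ≠ 0 := by exact_mod_cast hQ.ne'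
  have hs0 : s ≠ 0 := by
    refine zpow_ne_zero _ ?_
    have : Real.sqrt Q ≠ 0 := (Real.sqrt_pos.2 (by exact_mod_cast hQ)).ne'
    exact_mod_cast this
  haveI : NeZero N := ⟨by rw [hN]; positivity⟩
  set M := Q * (4 * N') with hM
  haveI : NeZero M := ⟨by positivity⟩
  have hM0 : 0 < M := by positivity
  have hNM : N ∣ M := ⟨4, by rw [hM, hN]; ring⟩
  have hM4 : 4 ≤ M := by
    rw [hM]
    have : 1 ≤ Q * N' := Nat.mul_pos hQ hN'
    nlinarith
  set p : PowerSeries ℂ := PowerSeries.mk fun n => c n / s with hp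
  have hg : HE Q ((⇑f) ∣[k] (g0 Q N' x y z w h)) p := by
    intro τ
    have h1 := (hc (qd Q hQ τ)).div_const s
    rw [hW, qm_qd, mul_div_cancel_left₀ _ hs0] at h1
    convert! h1 using 2 with i
    show PowerSeries.coeff i p * _ = _
    have e : 2 * (Real.pi : ℂ) * Complex.I * i * ((τ : ℂ) / Q) / ((1 : ℕ) : ℂ) =
        2 * (Real.pi : ℂ) * Complex.I * i * (τ : ℂ) / Q := by
      rw [Nat.cast_one]; ring
    rw [hp, PowerSeries.coeff_mk, qd_coe, e]
    ring
  have hgM := hg.expand (m := 4 * N') (by positivity) hQ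
  have hf1 : HE 1 f (PowerSeries.mk a) := by
    intro τ
    have := ha τ
    simpa using this
  have hfM := hf1.expand (m := M) hM0 one_pos
  rw [one_mul] at hfM
  refine ⟨c n / s, ?_, by field_simp⟩
  by_contra hmem
  obtain ⟨σ, hσ, hne⟩ := exists_aut_moving _ _ hmem
  apply hne
  obtain ⟨l, hl, hσl⟩ := sigma_unit (M := M) σ
  obtain ⟨l', hl'⟩ := hl.exists_right_inv
  have hf1c : HE 1 (fun τ => f τ + (σ (a 0) - a 0)) (PowerSeries.map σ (PowerSeries.mk a)) := by
    have h1 := hf1.add (HE.const 1 (σ (a 0) - a 0))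
    convert! h1 using 1
    ext i
    rw [PowerSeries.coeff_map, map_add, PowerSeries.coeff_mk, PowerSeries.coeff_C]
    rcases Nat.eq_zero_or_pos i with rfl | hi
    · simp
    · rw [if_neg hi.ne', add_zero]
      exact hσ _ (Subfield.subset_closure (Or.inl ⟨i, hi, rfl⟩))
  have hfMc := hf1c.expand (m := M) hM0 one_pos
  rw [one_mul, ← expandPS_map] at hfMc
  -- the unit is one modulo Q
  have hzeta : zetaC Q = chi M ((4 * N' : ℕ) : ZMod M) := by
    have := chi_coe (M := M) ((4 * N' : ℕ) : ℤ)
    rw [Int.cast_natCast] at this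
    rw [this, zetaC]
    congr 1
    have : (N' : ℂ) ≠ 0 := by exact_mod_cast hN'.ne'
    rw [hM]
    push_cast
    field_simp
  have hl1 : l * ((4 * N' : ℕ) : ZMod M) = ((4 * N' : ℕ) : ZMod M) := by
    apply chi_inj (M := M)
    rw [← sigma_chi σ l hσl, ← hzeta]
    exact hσ _ (Subfield.subset_closure (Or.inr rfl))
  have hl2 : l' * ((4 * N' : ℕ) : ZMod M) = ((4 * N' : ℕ) : ZMod M) := by
    conv_lhs => rw [← hl1]
    linear_combination ((4 * N' : ℕ) : ZMod M) * hl'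
  have hdvd : (N : ℤ) ∣ N' * ((l'.val : ℤ) - 1) := by
    have h1 : (((4 * N' : ℕ) : ℤ) * ((l'.val : ℤ) - 1) : ℤ) = ((4 : ℤ) * (N' * ((l'.val : ℤ) - 1))) := by
      push_cast; ring
    have h2 : ((((4 * N' : ℕ) : ℤ) * ((l'.val : ℤ) - 1) : ℤ) : ZMod M) = 0 := by
      push_cast
      push_cast at hl2
      rw [ZMod.natCast_zmod_val]
      linear_combination hl2
    rw [h1, ZMod.intCast_zmod_eq_zero_iff_dvd] at h2
    have h3 : (M : ℤ) = 4 * N := by rw [hM, hN]; push_cast; ring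
    rw [h3] at h2
    exact Int.dvd_of_mul_dvd_mul_left (by norm_num) h2
  set γ0 := g0 Q N' x y z w h with hγ0
  have hcop : IsCoprime ((![l' * brow M γ0 0, brow M γ0 1] : Fin 2 → ZMod M) 0)
      ((![l' * brow M γ0 0, brow M γ0 1] : Fin 2 → ZMod M) 1) :=
    (isCoprime_mul_unit_left_left (IsUnit.of_mul_eq_one l (by rw [mul_comm]; exact hl')) _ _).2
      (brow_cop M γ0)
  obtain ⟨γ, hγ⟩ := brow_surj _ hcop
  have hγ1 : va ![0, l] γ = ls l (brow M γ0) := by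
    have e0 : ((γ 1 0 : ℤ) : ZMod M) = l' * brow M γ0 0 := congrFun hγ 0
    have e1 : ((γ 1 1 : ℤ) : ZMod M) = brow M γ0 1 := congrFun hγ 1
    funext j
    fin_cases j
    · simp [va, ls, e0, ← mul_assoc, hl']
    · simp [va, ls, e1]
  have hγN : brow N γ = brow N γ0 := by
    have e0 : ((γ 1 0 : ℤ) : ZMod M) = l' * brow M γ0 0 := congrFun hγ 0
    have e1 : ((γ 1 1 : ℤ) : ZMod M) = brow M γ0 1 := congrFun hγ 1
    have e2 : ((γ 1 0 : ℤ) : ZMod M) = ((l'.val * (N' * z) : ℤ) : ZMod M) := by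
      rw [e0]; push_cast; rw [ZMod.natCast_zmod_val]; simp [brow, hγ0, g0]
    have hNMz : (N : ℤ) ∣ (M : ℤ) := by exact_mod_cast hNM
    funext j
    fin_cases j
    · show ((γ 1 0 : ℤ) : ZMod N) = ((γ0 1 0 : ℤ) : ZMod N)
      rw [ZMod.intCast_eq_intCast_iff_dvd_sub] at e2 ⊢
      have e3 : γ0 1 0 - γ 1 0 = (l'.val * (N' * z) - γ 1 0) - (N' * ((l'.val : ℤ) - 1)) * z := by
        have : γ0 1 0 = N' * z := by simp [hγ0, g0]
        rw [this]; ring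
      rw [e3]
      exact dvd_sub (hNMz.trans e2) (hdvd.mul_right z)
    · show ((γ 1 1 : ℤ) : ZMod N) = ((γ0 1 1 : ℤ) : ZMod N)
      have e4 : ((γ 1 1 : ℤ) : ZMod M) = ((γ0 1 1 : ℤ) : ZMod M) := e1
      rw [ZMod.intCast_eq_intCast_iff_dvd_sub] at e4 ⊢
      exact hNMz.trans e4
  have hfin := gal_main hk f hM4 hNM σ l hl hσl _ hfM _ hfMc γ0 γ hγ1 hγN _ hgM
  rw [expandPS_map] at hfin
  have hfin2 := expandPS_inj (by positivity) hfin
  have := congrArg (PowerSeries.coeff n) hfin2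
  rwa [PowerSeries.coeff_map, hp, PowerSeries.coeff_mk] at this

/-- diagonal matrix -/
def dm (Q : ℕ) (hQ : 0 < Q) : GL (Fin 2) ℝ :=
  Matrix.GeneralLinearGroup.mkOfDetNeZero !![(Q : ℝ), 0; 0, 1] (by
    rw [Matrix.det_fin_two_of]
    have : (Q : ℝ) ≠ 0 := by exact_mod_cast hQ.ne'
    simpa using this)

theorem dm_val (Q : ℕ) (hQ : 0 < Q) : (dm Q hQ).val = !![(Q : ℝ), 0; 0, 1] := rfl

theorem dm_slash (Q : ℕ) (hQ : 0 < Q) (k : ℤ) (g : ℍ → ℂ) (τ : ℍ) :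
    (g ∣[k] dm Q hQ) τ = (Q : ℂ) ^ (k - 1) * g (qm Q hQ τ) := by
  have hQr : (0 : ℝ) < Q := by exact_mod_cast hQ
  have hdet : (dm Q hQ).det.val = (Q : ℝ) := by
    rw [Matrix.GeneralLinearGroup.val_det_apply, dm_val, Matrix.det_fin_two_of]; simp
  have hσ : ∀ c, UpperHalfPlane.σ (dm Q hQ) c = c := by
    intro c
    rw [UpperHalfPlane.σ, if_pos (by rw [hdet]; exact hQr)]; rfl
  have hden : denom (dm Q hQ) τ = 1 := by
    simp [denom, dm_val]
  have hact : dm Q hQ • τ = qm Q hQ τ := by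
    ext
    rw [UpperHalfPlane.coe_smul_of_det_pos (by rw [hdet]; exact hQr), hden, qm_coe]
    simp [num, dm_val]
  rw [ModularForm.slash_apply, hσ, hdet, hden, hact, abs_of_pos hQr]
  push_cast
  simp
  ring

theorem dm_cusp (Q : ℕ) (hQ : 0 < Q) (c : OnePoint ℝ) (hc : IsCusp c 𝒮ℒ) :
    IsCusp (dm Q hQ • c) 𝒮ℒ := by
  rw [isCusp_SL2Z_iff] at hc ⊢
  obtain ⟨r, rfl⟩ := hc
  induction r using OnePoint.rec with
  | infty =>
    refine ⟨OnePoint.infty, ?_⟩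
    rw [OnePoint.map_infty, OnePoint.smul_infty_eq_ite]
    simp [dm_val]
  | coe r =>
    refine ⟨((Q * r : ℚ) : OnePoint ℚ), ?_⟩
    rw [OnePoint.map_some, OnePoint.map_some, OnePoint.smul_some_eq_ite]
    simp [dm_val]

theorem part_one (N Q N' : ℕ) (hN : N = Q * N') (hQ : 0 < Q) (hN' : 0 < N') (x y z w : ℤ)
    (h : (Q : ℤ) * x * w - N' * y * z = 1) (k : ℤ)
    (f : ModularForm (Gamma1 N) k) (WQf : ℍ → ℂ)
    (hW : ∀ τ : ℍ, WQf τ =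
      ((Real.sqrt Q : ℝ) : ℂ) ^ k * ((⇑f) ∣[k] (g0 Q N' x y z w h)) (qm Q hQ τ)) :
    ∃ F : ModularForm (Gamma1 N) k, ⇑F = WQf := by
  haveI : NeZero N := ⟨by rw [hN]; positivity⟩
  have hQC : (Q : ℂ) ≠ 0 := by exact_mod_cast hQ.ne'
  set γ0 := g0 Q N' x y z w h with hγ0
  set g := (⇑f) ∣[k] γ0 with hg
  have hinv : ∀ γ ∈ Gamma1 N, ∀ τ : ℍ, g (qm Q hQ (γ • τ)) = denom γ τ ^ k * g (qm Q hQ τ) := by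
    intro γ hγ τ
    obtain ⟨h00, h11, h10⟩ := (Gamma1_mem N γ).1 hγ
    have hdvd : (N : ℤ) ∣ γ 1 0 := (ZMod.intCast_zmod_eq_zero_iff_dvd _ _).1 h10
    obtain ⟨c, hc⟩ := hdvd
    have hdetγ := γ.2
    rw [Matrix.det_fin_two] at hdetγ
    let γ' : SL(2, ℤ) := ⟨!![γ 0 0, Q * γ 0 1; N' * c, γ 1 1], by
      have e := hdetγ
      rw [hc] at e
      have hNz : (N : ℤ) = Q * N' := by rw [hN]; push_cast; rfl
      rw [hNz] at e
      rw [Matrix.det_fin_two_of]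
      linear_combination e⟩
    have hden : denom γ' (qm Q hQ τ) = denom γ τ := by
      rw [denom_coe, denom_coe, hc, qm_coe, hN]
      simp [γ']; ring
    have hact : qm Q hQ (γ • τ) = γ' • qm Q hQ τ := by
      ext
      rw [smul_coe, ← denom_coe, hden, qm_coe, smul_coe, ← denom_coe, qm_coe]
      simp [γ']; ring
    rw [hact, hg, fs_smul, hden]
    congr 1
    refine congrFun (fs_brow f ?_) _
    have hNz : (Q : ZMod N) * (N' : ZMod N) = 0 := by
      rw [← Nat.cast_mul, ← hN, ZMod.natCast_self]
    rw [brow_mul]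
    funext j
    fin_cases j
    · simp [va, brow, hγ0, g0, γ', h00]
      linear_combination (w * c : ZMod N) * hNz
    · simp [va, brow, hγ0, g0, γ', h11]
      linear_combination (z * (γ 0 1) : ZMod N) * hNz
  let F0 : ModularForm (Gamma1 N) k :=
    { toFun := g ∣[k] dm Q hQ
      slash_action_eq' := by
        rintro _ ⟨γ, hγ, rfl⟩
        change (g ∣[k] dm Q hQ) ∣[k] γ = _
        funext τ
        rw [ModularForm.SL_slash_apply, dm_slash, dm_slash, hinv γ hγ, zpow_neg]
        have := zpow_ne_zero k (denom_ne γ τ)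
        field_simp
      holo' := (fs_hol f γ0).slash k _
      bdd_at_cusps' := by
        intro c hc
        have hc' := (Subgroup.IsArithmetic.isCusp_iff_isCusp_SL2Z
          ((Gamma1 N : Subgroup SL(2, ℤ)) : Subgroup (GL (Fin 2) ℝ))).1 hc
        have h1 := dm_cusp Q hQ c hc'
        rw [← OnePoint.IsBoundedAt.smul_iff, hg]
        change OnePoint.IsBoundedAt _ ((⇑f) ∣[k] (Matrix.SpecialLinearGroup.mapGL ℝ γ0)) k
        rw [← OnePoint.IsBoundedAt.smul_iff]
        have h2 := h1.smul_of_mem (g := Matrix.SpecialLinearGroup.mapGL ℝ γ0) ⟨γ0, rfl⟩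
        exact ModularFormClass.bdd_at_cusps f ((Subgroup.IsArithmetic.isCusp_iff_isCusp_SL2Z
          ((Gamma1 N : Subgroup SL(2, ℤ)) : Subgroup (GL (Fin 2) ℝ))).2 h2) }
  refine ⟨(((Real.sqrt Q : ℝ) : ℂ) ^ k * ((Q : ℂ) ^ (k - 1))⁻¹) • F0, ?_⟩
  funext τ
  rw [hW]
  have h3 : F0 τ = (Q : ℂ) ^ (k - 1) * g (qm Q hQ τ) := dm_slash Q hQ k g τ
  show (((Real.sqrt Q : ℝ) : ℂ) ^ k * ((Q : ℂ) ^ (k - 1))⁻¹) * F0 τ = _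
  rw [h3]
  have := zpow_ne_zero (k - 1) hQC
  field_simp

/-- Let `Q` be a positive divisor of `N` with `gcd(Q, N/Q) = 1`, choose
`x ≡ 1 (mod N/Q)`, `y ≡ 1 (mod Q)` with `Q²xw − Nyz = Q` and define
`(f|_k W_Q)(τ) = Q^{k/2} (Nzτ+Qw)^{−k} f((Qxτ+y)/(Nzτ+Qw))`. Then for every modular form
`f` of weight `k` on `Γ₁(N)`, the function `f|_k W_Q` is a modular form of weight `k` on
`Γ₁(N)`, and all its Fourier coefficients lie in `Q^{k/2}·K_f(ζ_Q)`. -/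
theorem stmt_11 (N Q : ℕ) (hN : 1 ≤ N) (k : ℤ) (hk : 1 ≤ k)
    (hQpos : 0 < Q) (hQdvd : Q ∣ N) (hQcop : Nat.gcd Q (N / Q) = 1)
    (x y z w : ℤ)
    (hx : x ≡ 1 [ZMOD ((N / Q : ℕ) : ℤ)]) (hy : y ≡ 1 [ZMOD (Q : ℤ)])
    (hdet : (Q : ℤ) ^ 2 * x * w - N * y * z = Q)
    (f : ModularForm (Gamma1 N) k)
    (a : ℕ → ℂ) (ha : HasExpansion 1 (⇑f) a)
    (WQf : ℍ → ℂ)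
    (hWQf : ∀ τ τ' : ℍ,
      (τ' : ℂ) = ((Q : ℂ) * x * (τ : ℂ) + y) / ((N : ℂ) * z * (τ : ℂ) + Q * w) →
      WQf τ = (Real.sqrt Q : ℂ) ^ k * ((N : ℂ) * z * (τ : ℂ) + Q * w) ^ (-k) * f τ') :
    (∃ F : ModularForm (Gamma1 N) k, ⇑F = WQf) ∧
    ∀ c : ℕ → ℂ, HasExpansion 1 WQf c → ∀ n : ℕ,
      ∃ t ∈ Subfield.closure ({v : ℂ | ∃ j : ℕ, 1 ≤ j ∧ v = a j} ∪ {zetaC Q}),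
        c n = (Real.sqrt Q : ℂ) ^ k * t := by
  obtain ⟨N', hNN⟩ := hQdvd
  have hN' : 0 < N' := by
    rcases Nat.eq_zero_or_pos N' with h0 | h0
    · rw [h0] at hNN; omega
    · exact h0
  have h : (Q : ℤ) * x * w - N' * y * z = 1 := by
    have hQz : (Q : ℤ) ≠ 0 := by exact_mod_cast hQpos.ne'
    have hNz : (N : ℤ) = Q * N' := by rw [hNN]; push_cast; rfl
    rw [hNz] at hdet
    apply mul_left_cancel₀ hQz
    linear_combination hdet
  have hW := W_eq Q N' hQpos x y z w h k (⇑f) WQf (by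
    intro τ τ' hτ
    rw [← hNN] at hτ ⊢
    exact hWQf τ τ' hτ)
  exact ⟨part_one N Q N' hNN hQpos hN' x y z w h k f WQf hW,
    fun c hc n => part_two N Q N' hNN hQpos hN' x y z w h k hk f a ha WQf hW c hc n⟩
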